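/- arXiv:2505.03014 — 2 statements merged into one kernel-verified Lean document; each statement's English description precedes it below -/
import Mathlib

section
/- The set of smallest adjacency eigenvalues attained by finite simple graphs with chromatic number at most 3, i.e. {λ₁(G) : G a finite simple graph with chromatic number ≤ 3}, is dense in the open interval (-∞, -λ*). -/
open scoped Classical in
/-- The real adjacency matrix of a finite simple graph on `Fin n`. -/
noncomputable def adjMat {n : ℕ} (G : SimpleGraph (Fin n)) : Matrix (Fin n) (Fin n) ℝ :=
  Matrix.of fun u v => if G.Adj u v then 1 else 0

/-- The smallest eigenvalue of the real adjacency matrix of a finite simple graph. -/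
noncomputable def lam1 {n : ℕ} (G : SimpleGraph (Fin n)) : ℝ :=
  sInf {t : ℝ | ∃ x : Fin n → ℝ, x ≠ 0 ∧ (adjMat G).mulVec x = t • x}

section Graphs

variable {V W : Type*}

open scoped Classical in
/-- The value `c` if `p` holds, and `0` otherwise. -/
noncomputable def valueIf (p : Prop) (c : ℝ) : ℝ := if p then c else 0

/-- The quadratic form of `lam • 1 + A`, where `A` is the adjacency matrix of `G`. -/
noncomputable def shiftedForm [Fintype V] (G : SimpleGraph V) (lam : ℝ) (x : V → ℝ) : ℝ :=
  lam * ∑ u, x u ^ 2 + ∑ u, ∑ v, valueIf (G.Adj u v) (x u * x v)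

/-- The disjoint union of `G` and `H` together with the edge `ab`. -/
def joinGraph (G : SimpleGraph V) (H : SimpleGraph W) (a : V) (b : W) :
    SimpleGraph (V ⊕ W) where
  Adj
    | .inl u, .inl v => G.Adj u v
    | .inr u, .inr v => H.Adj u v
    | .inl u, .inr v => u = a ∧ v = b
    | .inr u, .inl v => v = a ∧ u = b
  symm := ⟨by
    rintro (u | u) (v | v) h
    · exact G.adj_symm h
    · exact h
    · exact h
    · exact H.adj_symm h⟩
  loopless := ⟨by
    rintro (u | u) h
    · exact G.loopless.irrefl u h
    · exact H.loopless.irrefl u h⟩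

/-- The graph `G` together with a new vertex adjacent to `a` and `b`. -/
def coneGraph (G : SimpleGraph V) (a b : V) : SimpleGraph (Option V) where
  Adj
    | some u, some v => G.Adj u v
    | none, some v => v = a ∨ v = b
    | some v, none => v = a ∨ v = b
    | none, none => False
  symm := ⟨by
    rintro (_ | u) (_ | v) h
    · exact h
    · exact h
    · exact h
    · exact G.adj_symm h⟩
  loopless := ⟨by
    rintro (_ | u) h
    · exact h
    · exact G.loopless.irrefl u h⟩

theorem sum_valueIf_and [Fintype V] [Fintype W] (a : V) (b : W) (c : V → W → ℝ) :
    ∑ u, ∑ v, valueIf (u = a ∧ v = b) (c u v) = c a b := by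
  classical
  rw [Finset.sum_eq_single a, Finset.sum_eq_single b]
  · simp [valueIf]
  · simp +contextual [valueIf]
  · simp
  · simp +contextual [valueIf]
  · simp

theorem sum_valueIf_or [Fintype V] {a b : V} (hab : a ≠ b) (c : V → ℝ) :
    ∑ v, valueIf (v = a ∨ v = b) (c v) = c a + c b := by
  classical
  have h : ∀ v, valueIf (v = a ∨ v = b) (c v)
      = (if v = a then c v else 0) + (if v = b then c v else 0) := by
    intro v
    by_cases h₁ : v = a <;> by_cases h₂ : v = b <;> simp_all [valueIf]
  simp [h, Finset.sum_add_distrib]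

theorem shiftedForm_joinGraph [Fintype V] [Fintype W] (G : SimpleGraph V) (H : SimpleGraph W)
    (a : V) (b : W) (lam : ℝ) (x : V ⊕ W → ℝ) :
    shiftedForm (joinGraph G H a b) lam x =
      shiftedForm G lam (x ∘ .inl) + shiftedForm H lam (x ∘ .inr)
        + 2 * (x (.inl a) * x (.inr b)) := by
  simp only [shiftedForm, joinGraph, Fintype.sum_sum_type, Finset.sum_add_distrib,
    Function.comp_apply, sum_valueIf_and]
  rw [Finset.sum_comm (s := (Finset.univ : Finset W)), sum_valueIf_and]
  ring

theorem shiftedForm_coneGraph [Fintype V] (G : SimpleGraph V) {a b : V} (hab : a ≠ b)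
    (lam : ℝ) (x : Option V → ℝ) :
    shiftedForm (coneGraph G a b) lam x =
      shiftedForm G lam (x ∘ some) + lam * x none ^ 2
        + 2 * (x none * (x (some a) + x (some b))) := by
  simp only [shiftedForm, coneGraph, Fintype.sum_option, Finset.sum_add_distrib,
    sum_valueIf_or hab, Function.comp_apply]
  simp only [valueIf, if_false]
  ring

theorem joinGraph_colorable {G : SimpleGraph V} {H : SimpleGraph W} (hG : G.Colorable 3)
    (hH : H.Colorable 3) (a : V) (b : W) : (joinGraph G H a b).Colorable 3 := by
  obtain ⟨c⟩ := hG
  obtain ⟨d⟩ := hH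
  let e : Fin 3 ≃ Fin 3 := Equiv.swap (d b) (c a + 1)
  have he : c a ≠ e (d b) := by
    simp [e]
  refine ⟨SimpleGraph.Coloring.mk (Sum.elim c fun w => e (d w)) ?_⟩
  rintro (u | u) (v | v) h
  · exact c.valid h
  · obtain ⟨rfl, rfl⟩ := h
    exact he
  · obtain ⟨rfl, rfl⟩ := h
    exact he.symm
  · exact fun h' => d.valid (v := u) (w := v) h (e.injective h')

theorem coneGraph_colorable {G : SimpleGraph V} (hG : G.Colorable 3) (a b : V) :
    (coneGraph G a b).Colorable 3 := by
  obtain ⟨c⟩ := hG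
  obtain ⟨i, hi⟩ : ∃ i : Fin 3, i ≠ c a ∧ i ≠ c b := by
    generalize c a = p
    generalize c b = q
    revert p q
    decide
  have hne : ∀ v, v = a ∨ v = b → i ≠ c v := by
    rintro v (rfl | rfl)
    exacts [hi.1, hi.2]
  refine ⟨SimpleGraph.Coloring.mk (fun o => o.elim i c) ?_⟩
  rintro (_ | u) (_ | v) h
  · exact h.elim
  · exact hne v h
  · exact (hne u h).symm
  · exact c.valid h

end Graphs

/-- Some rooted `3`-colorable graph has minimum `r` for the form `shiftedForm G lam` on
vectors whose value at the root is `1`. -/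
def RootValue (lam r : ℝ) : Prop :=
  ∃ (V : Type) (_ : Fintype V) (G : SimpleGraph V) (v : V), G.Colorable 3 ∧
    (∀ x : V → ℝ, r * x v ^ 2 ≤ shiftedForm G lam x) ∧
    ∃ x : V → ℝ, x v = 1 ∧ shiftedForm G lam x = r

/-- The values by which attaching a (possibly empty) branch to a root lowers its root value. -/
def IsBranch (lam y : ℝ) : Prop :=
  y = 0 ∨ 0 < y ∧ RootValue lam y⁻¹

theorem shiftedForm_smul {V : Type*} [Fintype V] (G : SimpleGraph V) (lam c : ℝ) (x : V → ℝ) :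
    shiftedForm G lam (c • x) = c ^ 2 * shiftedForm G lam x := by
  classical
  simp only [shiftedForm, Pi.smul_apply, smul_eq_mul, mul_add, Finset.mul_sum]
  congr 1
  · exact Finset.sum_congr rfl fun u _ => by ring
  · refine Finset.sum_congr rfl fun u _ => Finset.sum_congr rfl fun v _ => ?_
    unfold valueIf
    split_ifs <;> ring

theorem rootValue_self (lam : ℝ) : RootValue lam lam :=
  ⟨Unit, inferInstance, ⊥, (), ⟨SimpleGraph.Coloring.mk (fun _ => 0) (by simp)⟩,
    by simp [shiftedForm, valueIf], fun _ => 1, by simp [shiftedForm, valueIf]⟩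

theorem RootValue.sub_inv {lam r s : ℝ} (hr : RootValue lam r) (hs : RootValue lam s)
    (hs0 : 0 < s) : RootValue lam (r - s⁻¹) := by
  obtain ⟨V, _, G, v, hG, hle, x, hxv, hx⟩ := hr
  obtain ⟨W, _, H, w, hH, hle', z, hzw, hz⟩ := hs
  refine ⟨V ⊕ W, inferInstance, joinGraph G H v w, .inl v, joinGraph_colorable hG hH v w,
    fun f => ?_, Sum.elim x ((-s⁻¹) • z), by simpa using hxv, ?_⟩
  · rw [shiftedForm_joinGraph]
    have h₁ := hle (f ∘ .inl)
    have h₂ := hle' (f ∘ .inr)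
    simp only [Function.comp_apply] at h₁ h₂
    have h₃ : 0 ≤ s * (f (.inr w) + s⁻¹ * f (.inl v)) ^ 2 := by positivity
    have h₄ : s * (f (.inr w) + s⁻¹ * f (.inl v)) ^ 2 = s * f (.inr w) ^ 2
        + 2 * (f (.inl v) * f (.inr w)) + s⁻¹ * f (.inl v) ^ 2 := by
      field_simp
      ring
    linarith
  · rw [shiftedForm_joinGraph, Sum.elim_comp_inl, Sum.elim_comp_inr, shiftedForm_smul, hx, hz]
    simp [hxv, hzw]
    field_simp
    ring

theorem RootValue.sub {lam r y : ℝ} (hr : RootValue lam r) (hy : IsBranch lam y) :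
    RootValue lam (r - y) := by
  obtain rfl | ⟨h0, hy⟩ := hy
  · simpa using hr
  · simpa using hr.sub_inv hy (inv_pos.2 h0)

theorem RootValue.isBranch_inv {lam r : ℝ} (hr : RootValue lam r) (h0 : 0 < r) :
    IsBranch lam r⁻¹ :=
  Or.inr ⟨inv_pos.2 h0, by simpa using hr⟩

theorem RootValue.triangle {lam r s : ℝ} (hr : RootValue lam r) (hs : RootValue lam s)
    (hr1 : 1 < r) (hs1 : 1 < s) :
    RootValue lam (lam - (r + s - 2) / (r * s - 1)) := by
  obtain ⟨V, _, G, v, hG, hle, x, hxv, hx⟩ := hr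
  obtain ⟨W, _, H, w, hH, hle', z, hzw, hz⟩ := hs
  have hd : 0 < r * s - 1 := by nlinarith
  refine ⟨Option (V ⊕ W), inferInstance, coneGraph (joinGraph G H v w) (.inl v) (.inr w), none,
    coneGraph_colorable (joinGraph_colorable hG hH v w) _ _, fun f => ?_,
    fun o => o.elim 1
      (Sum.elim ((-(s - 1) / (r * s - 1)) • x) ((-(r - 1) / (r * s - 1)) • z)), rfl, ?_⟩
  · rw [shiftedForm_coneGraph _ (by simp), shiftedForm_joinGraph]
    have h₁ := hle ((f ∘ some) ∘ .inl)
    have h₂ := hle' ((f ∘ some) ∘ .inr)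
    simp only [Function.comp_apply] at h₁ h₂ ⊢
    generalize f (some (.inl v)) = b at *
    generalize f (some (.inr w)) = c at *
    generalize f none = a at *
    have h₃ : 0 ≤ r * (b + (a + c) / r) ^ 2
        + (r * s - 1) / r * (c + (r - 1) / (r * s - 1) * a) ^ 2 := by positivity
    have h₄ : r * (b + (a + c) / r) ^ 2
        + (r * s - 1) / r * (c + (r - 1) / (r * s - 1) * a) ^ 2
        = r * b ^ 2 + s * c ^ 2 + 2 * (b * c) + 2 * (a * (b + c))
          + (r + s - 2) / (r * s - 1) * a ^ 2 := by
      have : r ≠ 0 := by positivity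
      field_simp
      ring
    linarith
  · rw [shiftedForm_coneGraph _ (by simp), shiftedForm_joinGraph]
    have e₁ : ((fun o : Option (V ⊕ W) => o.elim 1 (Sum.elim ((-(s - 1) / (r * s - 1)) • x)
        ((-(r - 1) / (r * s - 1)) • z)) : Option (V ⊕ W) → ℝ) ∘ some) ∘ Sum.inl
        = (-(s - 1) / (r * s - 1)) • x := rfl
    have e₂ : ((fun o : Option (V ⊕ W) => o.elim 1 (Sum.elim ((-(s - 1) / (r * s - 1)) • x)
        ((-(r - 1) / (r * s - 1)) • z)) : Option (V ⊕ W) → ℝ) ∘ some) ∘ Sum.inr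
        = (-(r - 1) / (r * s - 1)) • z := rfl
    rw [e₁, e₂, shiftedForm_smul, shiftedForm_smul, hx, hz]
    have hA : (r * s - 1) * (r * s - 1)⁻¹ = 1 := mul_inv_cancel₀ hd.ne'
    simp only [Function.comp_apply, Option.elim_none, Option.elim_some, Sum.elim_inl,
      Sum.elim_inr, Pi.smul_apply, smul_eq_mul, hxv, hzw, div_eq_mul_inv]
    linear_combination (r + s - 2) * (r * s - 1)⁻¹ * hA

theorem mem_closure_of_rootValue {lam : ℝ}
    (h : ∀ η > 0, ∃ r, 0 ≤ r ∧ r < η ∧ RootValue lam r) :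
    -lam ∈ closure {t : ℝ | ∃ (n : ℕ) (G : SimpleGraph (Fin n)),
        G.chromaticNumber ≤ 3 ∧ lam1 G = t} := by
  classical
  rw [Metric.mem_closure_iff]
  intro η hη
  obtain ⟨r, hr0, hrη, V, _, G, v, hG, hle, x, hxv, hx⟩ := h η hη
  let e : Fin (Fintype.card V) ≃ V := (Fintype.equivFin V).symm
  let G' := G.comap e
  have hform : ∀ f : V → ℝ, shiftedForm G' lam (f ∘ e) = shiftedForm G lam f := by
    intro f
    simp only [shiftedForm, G', SimpleGraph.comap_adj, Function.comp_apply]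
    rw [e.sum_comp (fun u => f u ^ 2)]
    congr 1
    rw [← e.sum_comp (fun u => ∑ v, valueIf (G.Adj u v) (f u * f v))]
    refine Finset.sum_congr rfl fun u _ => ?_
    rw [← e.sum_comp (fun w => valueIf (G.Adj (e u) w) (f (e u) * f w))]
  have hdot : ∀ f : Fin (Fintype.card V) → ℝ, shiftedForm G' lam f
      = lam * (f ⬝ᵥ f) + f ⬝ᵥ (adjMat G').mulVec f := by
    intro f
    simp only [shiftedForm, valueIf, dotProduct, Matrix.mulVec, adjMat, Matrix.of_apply,
      Finset.mul_sum]
    congr 1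
    · exact Finset.sum_congr rfl fun u _ => by ring
    · refine Finset.sum_congr rfl fun u _ => Finset.sum_congr rfl fun w _ => ?_
      split_ifs <;> ring
  have hnonneg : ∀ f : Fin (Fintype.card V) → ℝ,
      0 ≤ lam * (f ⬝ᵥ f) + f ⬝ᵥ (adjMat G').mulVec f := by
    intro f
    have h₁ := hle (f ∘ e.symm)
    rw [← hform, Function.comp_assoc, e.symm_comp_self, Function.comp_id, hdot] at h₁
    exact (by positivity : 0 ≤ r * (f ∘ e.symm) v ^ 2).trans h₁
  set S := {t : ℝ | ∃ x : Fin (Fintype.card V) → ℝ, x ≠ 0 ∧ (adjMat G').mulVec x = t • x}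
    with hS
  have hlb : ∀ t ∈ S, -lam ≤ t := by
    rintro t ⟨f, hf0, hf⟩
    have h₁ := hnonneg f
    rw [hf, dotProduct_smul, smul_eq_mul, ← add_mul] at h₁
    have h₂ : 0 < f ⬝ᵥ f := by
      have := Matrix.dotProduct_star_self_pos_iff.2 hf0
      simpa using this
    linarith [nonneg_of_mul_nonneg_left h₁ h₂]
  have hbdd : BddBelow S := ⟨-lam, hlb⟩
  have hA : (adjMat G').IsHermitian := by
    ext i j
    simp [adjMat, G'.adj_comm]
  have : Nonempty (Fin (Fintype.card V)) := ⟨e.symm v⟩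
  have hmem : ∀ i, hA.eigenvalues i ∈ S := fun i =>
    ⟨hA.eigenvectorBasis i, by
      intro h0
      exact hA.eigenvectorBasis.orthonormal.ne_zero i (by ext j; exact congrFun h0 j),
      hA.mulVec_eigenvectorBasis i⟩
  have hray : lam1 G' * ((x ∘ e) ⬝ᵥ (x ∘ e)) ≤ (x ∘ e) ⬝ᵥ (adjMat G').mulVec (x ∘ e) := by
    have hB : (adjMat G' - lam1 G' • (1 : Matrix _ _ ℝ)).IsHermitian := by
      refine hA.sub ?_
      ext i j
      simp [Matrix.one_apply, eq_comm]
    have hps : (adjMat G' - lam1 G' • (1 : Matrix _ _ ℝ)).PosSemidef := by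
      rw [hB.posSemidef_iff_eigenvalues_nonneg]
      intro i
      have h₁ := hB.mulVec_eigenvectorBasis i
      have h₂ : hB.eigenvalues i + lam1 G' ∈ S := by
        refine ⟨hB.eigenvectorBasis i, ?_, ?_⟩
        · intro h0
          exact hB.eigenvectorBasis.orthonormal.ne_zero i (by ext j; exact congrFun h0 j)
        · rw [Matrix.sub_mulVec, Matrix.smul_mulVec, Matrix.one_mulVec] at h₁
          rw [add_smul, ← h₁]
          simp
      have h₃ : lam1 G' ≤ _ := csInf_le hbdd h₂
      simpa using h₃
    have h₁ := hps.dotProduct_mulVec_nonneg (x ∘ e)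
    rw [Matrix.sub_mulVec, Matrix.smul_mulVec, Matrix.one_mulVec, dotProduct_sub,
      dotProduct_smul, smul_eq_mul] at h₁
    simpa using h₁
  refine ⟨lam1 G', ⟨_, G', ?_, rfl⟩, ?_⟩
  · exact SimpleGraph.chromaticNumber_le_iff_colorable.2
      (hG.of_hom (⟨e, fun h => h⟩ : G' →g G))
  · have h₁ : -lam ≤ lam1 G' := le_csInf ⟨_, hmem (Classical.arbitrary _)⟩ hlb
    have h₂ : lam * ((x ∘ e) ⬝ᵥ (x ∘ e)) + (x ∘ e) ⬝ᵥ (adjMat G').mulVec (x ∘ e) = r := by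
      rw [← hdot, hform, hx]
    have h₃ : 1 ≤ (x ∘ e) ⬝ᵥ (x ∘ e) := by
      have := Finset.single_le_sum (f := fun i => (x ∘ e) i * (x ∘ e) i)
        (fun i _ => mul_self_nonneg _) (Finset.mem_univ (e.symm v))
      simpa [hxv, dotProduct] using this
    rw [dist_comm, Real.dist_eq, abs_of_nonneg (by linarith)]
    nlinarith

/-- The reals that are limits of elements of `S` from below. -/
def approxBelow (S : Set ℝ) : Set ℝ :=
  {u | ∀ η > 0, ∃ a ∈ S, a ≤ u ∧ u < a + η}

theorem subset_approxBelow (S : Set ℝ) : S ⊆ approxBelow S :=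
  fun u hu _ hη => ⟨u, hu, le_rfl, by linarith⟩

theorem approxBelow_approxBelow_subset (S : Set ℝ) :
    approxBelow (approxBelow S) ⊆ approxBelow S := by
  intro u hu η hη
  obtain ⟨a, ha, h₁, h₂⟩ := hu (η / 2) (by linarith)
  obtain ⟨b, hb, h₃, h₄⟩ := ha (η / 2) (by linarith)
  exact ⟨b, hb, by linarith, by linarith⟩

/-- If every point of a bounded set `I` can be approached from below through a contraction
applied to an approximation of another point of `I`, then `I` is approximated from below. -/
theorem subset_approxBelow_of_contraction {S I : Set ℝ} {κ M : ℝ} (hκ0 : 0 ≤ κ) (hκ1 : κ < 1)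
    (hI : ∀ u ∈ I, 0 ≤ u ∧ u ≤ M) (h0 : (0 : ℝ) ∈ S)
    (step : ∀ u ∈ I, ∃ u' ∈ I, ∀ a ∈ S, a ≤ u' → ∃ b ∈ S, b ≤ u ∧ u - b ≤ κ * (u' - a)) :
    I ⊆ approxBelow S := by
  have key : ∀ n : ℕ, ∀ u ∈ I, ∃ a ∈ S, a ≤ u ∧ u - a ≤ κ ^ n * M := by
    intro n
    induction n with
    | zero => exact fun u hu => ⟨0, h0, (hI u hu).1, by simpa using (hI u hu).2⟩
    | succ n ih =>
      intro u hu
      obtain ⟨u', hu', h⟩ := step u hu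
      obtain ⟨a, ha, hau, hle⟩ := ih u' hu'
      obtain ⟨b, hb, hbu, hle'⟩ := h a ha hau
      refine ⟨b, hb, hbu, hle'.trans ?_⟩
      rw [pow_succ', mul_assoc]
      exact mul_le_mul_of_nonneg_left hle hκ0
  intro u hu η hη
  have hM : 0 ≤ M := (hI u hu).1.trans (hI u hu).2
  obtain ⟨n, hn⟩ := exists_pow_lt_of_lt_one (show 0 < η / (M + 1) by positivity) hκ1
  obtain ⟨a, ha, hau, hle⟩ := key n u hu
  refine ⟨a, ha, hau, ?_⟩
  rw [lt_div_iff₀ (by positivity)] at hn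
  have : 0 ≤ κ ^ n := pow_nonneg hκ0 n
  nlinarith

/-- A sequence with steps at most `g` leaves no gap longer than `g` below its limit. -/
theorem exists_le_and_le_add {a : ℕ → ℝ} {l g v : ℝ} (ha : ∀ η > 0, ∃ n, l - η < a n)
    (hg : ∀ n, a (n + 1) ≤ a n + g) (h0 : a 0 ≤ v) (hv : v < l) :
    ∃ n, a n ≤ v ∧ v ≤ a n + g := by
  classical
  have hex : ∃ n, v < a n := by
    obtain ⟨n, hn⟩ := ha (l - v) (by linarith)
    exact ⟨n, by linarith⟩
  obtain ⟨m, hm⟩ : ∃ m, Nat.find hex = m + 1 :=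
    Nat.exists_eq_succ_of_ne_zero fun h => (Nat.find_spec hex).not_ge (by rwa [h])
  refine ⟨m, not_lt.1 (Nat.find_min hex (by omega)), ?_⟩
  have := Nat.find_spec hex
  rw [hm] at this
  exact this.le.trans (hg m)

section Caterpillars

theorem rootValue_sub_nat_mul_inv {lam : ℝ} (hlam : 0 < lam) (k : ℕ) :
    RootValue lam (lam - k * lam⁻¹) := by
  induction k with
  | zero => simpa using rootValue_self lam
  | succ k ih =>
    have := ih.sub_inv (rootValue_self lam) hlam
    convert this using 1
    push_cast
    ring

theorem exists_nat_sub_mul_mem {α p z : ℝ} (hp : 0 < p) (hz : α ≤ z) :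
    ∃ k : ℕ, α ≤ z - k * p ∧ z - k * p < α + p := by
  refine ⟨⌊(z - α) / p⌋₊, ?_, ?_⟩
  · have := Nat.floor_le (div_nonneg (sub_nonneg.2 hz) hp.le)
    rw [le_div_iff₀ hp] at this
    linarith
  · have := Nat.lt_floor_add_one ((z - α) / p)
    rw [div_lt_iff₀ hp] at this
    linarith

/-- Prepending a vertex with `k` pendant neighbours to a branch contracts by a factor `y ^ 2`. -/
theorem exists_caterpillar_step {lam α y : ℝ} (hlam : 0 < lam) (hα : 0 < α)
    (hα2 : α ^ 2 + 1 = lam * α) (hy : α ≤ y) :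
    ∃ (k : ℕ) (y' : ℝ), α ≤ y' ∧ y' < α + lam⁻¹ ∧ y * (lam - k * lam⁻¹ - y') = 1 ∧
      ∀ a ∈ {y | IsBranch lam y}, a ≤ y' →
        ∃ b ∈ {y | IsBranch lam y}, b ≤ y ∧ y - b ≤ y ^ 2 * (y' - a) := by
  have hy0 : 0 < y := hα.trans_le hy
  have hz : α ≤ lam - y⁻¹ := by
    have h₁ : y⁻¹ ≤ α⁻¹ := inv_anti₀ hα hy
    have h₂ : lam = α + α⁻¹ := by
      field_simp
      linarith
    linarith
  obtain ⟨k, hk₁, hk₂⟩ := exists_nat_sub_mul_mem (inv_pos.2 hlam) hz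
  refine ⟨k, lam - y⁻¹ - k * lam⁻¹, hk₁, hk₂, ?_, ?_⟩
  · ring_nf
    exact mul_inv_cancel₀ hy0.ne'
  · intro a ha hle
    have hr := (rootValue_sub_nat_mul_inv hlam k).sub ha
    have hle' : y⁻¹ ≤ lam - k * lam⁻¹ - a := by linarith
    generalize hrdef : lam - k * lam⁻¹ - a = r at *
    have hr0 : 0 < r := (inv_pos.2 hy0).trans_le hle'
    have hb : r⁻¹ ≤ y := by
      have := inv_anti₀ (inv_pos.2 hy0) hle'
      rwa [inv_inv] at this
    refine ⟨r⁻¹, hr.isBranch_inv hr0, hb, ?_⟩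
    have h₁ : lam - y⁻¹ - k * lam⁻¹ - a = r - y⁻¹ := by linarith
    rw [h₁]
    have h₂ : y - r⁻¹ = y * r⁻¹ * (r - y⁻¹) := by
      field_simp
    rw [h₂, sq]
    exact mul_le_mul_of_nonneg_right (mul_le_mul_of_nonneg_left hb hy0.le) (by linarith)

theorem exists_rootValue_of_ge {lam : ℝ} (h : 13 / 6 ≤ lam) :
    ∀ η > 0, ∃ r, 0 ≤ r ∧ r < η ∧ RootValue lam r := by
  have hlam : 0 < lam := by linarith
  obtain ⟨α, hα, hα1, hα2⟩ : ∃ α : ℝ, 0 < α ∧ α ≤ 2 / 3 ∧ α ^ 2 + 1 = lam * α := by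
    have hs : 0 ≤ lam ^ 2 - 4 := by nlinarith
    have hsq := Real.sq_sqrt hs
    have hs0 := Real.sqrt_nonneg (lam ^ 2 - 4)
    refine ⟨(lam - √(lam ^ 2 - 4)) / 2, ?_, ?_, ?_⟩
    · nlinarith
    · nlinarith
    · nlinarith
  have hp : 0 < lam⁻¹ := inv_pos.2 hlam
  have hplam : lam * lam⁻¹ = 1 := mul_inv_cancel₀ hlam.ne'
  have hp1 : lam⁻¹ ≤ 6 / 13 := by
    have := inv_anti₀ (by norm_num) h
    norm_num at this
    exact this
  have hαinv : α⁻¹ = lam - α := by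
    field_simp
    linarith
  have hαinv' : 3 / 2 ≤ α⁻¹ := by
    have := inv_anti₀ hα hα1
    norm_num at this
    exact this
  have hd : 1 < α⁻¹ - lam⁻¹ := by linarith
  set p := lam⁻¹ with hpdef
  set β := (α⁻¹ - p)⁻¹ with hβ
  set c := (α + p) * (lam - p) - 1 with hc
  have hβ0 : 0 < β := inv_pos.2 (by linarith)
  have hβ1 : β < 1 := inv_lt_one_of_one_lt₀ hd
  have hc1 : c < 1 := by
    have h₁ : α = p * (1 + α ^ 2) := by linear_combination (-p) * hα2 - α * hplam
    have h₂ : c = α ^ 2 + 1 - p * (α + p) := by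
      rw [hc]
      linear_combination (-1) * hα2 + hplam
    have h₃ : α ^ 2 ≤ 4 / 9 := by nlinarith
    have h₄ : (1 + α ^ 2) ^ 2 < 2 + α ^ 2 := by nlinarith [sq_nonneg α]
    have h₅ : α ^ 2 < p * (α + p) := by
      have h₆ : α ^ 2 = p ^ 2 * (1 + α ^ 2) ^ 2 := by
        rw [← mul_pow, ← h₁]
      have h₇ : p * (α + p) = p ^ 2 * (2 + α ^ 2) := by linear_combination p * h₁
      have h₈ := mul_lt_mul_of_pos_left h₄ (show 0 < p ^ 2 by positivity)
      linarith
    linarith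
  have hsub : Set.Ico α (α + p) ⊆ approxBelow {y | IsBranch lam y} := by
    refine subset_approxBelow_of_contraction (κ := max (β ^ 2) (c ^ 2)) (M := α + p)
      (le_max_of_le_left (sq_nonneg β)) (max_lt ?_ ?_)
      (fun y hy => ⟨hα.le.trans hy.1, hy.2.le⟩) (Or.inl rfl) ?_
    · nlinarith
    · have : 0 < c + 1 := by
        rw [hc]
        have : 0 < lam - p := by linarith
        have := mul_pos (add_pos hα hp) this
        linarith
      nlinarith
    · rintro y ⟨hy₁, hy₂⟩
      have hy0 : 0 < y := hα.trans_le hy₁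
      obtain ⟨k, y', hy'₁, hy'₂, heq, hstep⟩ := exists_caterpillar_step hlam hα hα2 hy₁
      rcases le_or_gt y β with hyβ | hyβ
      · refine ⟨y', ⟨hy'₁, hy'₂⟩, fun a ha hle => ?_⟩
        obtain ⟨b, hb, hby, hyb⟩ := hstep a ha hle
        refine ⟨b, hb, hby, hyb.trans (mul_le_mul_of_nonneg_right ?_ (by linarith))⟩
        exact (pow_le_pow_left₀ hy0.le hyβ 2).trans (le_max_left _ _)
      · have hk : 1 ≤ k := by
          by_contra hk
          obtain rfl : k = 0 := by omega
          have h₁ : y⁻¹ < α⁻¹ - p := by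
            have := inv_strictAnti₀ hβ0 hyβ
            rwa [hβ, inv_inv] at this
          have h₂ : lam - y' = y⁻¹ := by
            refine eq_inv_of_mul_eq_one_right ?_
            simpa using heq
          linarith
        have hk' : (1 : ℝ) ≤ k := by exact_mod_cast hk
        have hyy : y * y' ≤ c := by
          have h₁ : y * y' = y * (lam - k * p) - 1 := by linear_combination (-1) * heq
          have h₂ : y * (lam - k * p) ≤ (α + p) * (lam - p) := by
            refine mul_le_mul hy₂.le (by nlinarith) ?_ (by positivity)
            by_contra hneg
            nlinarith
          linarith
        have hy'0 : 0 < y' := hα.trans_le hy'₁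
        obtain ⟨_, y'', hy''₁, hy''₂, -, hstep'⟩ := exists_caterpillar_step hlam hα hα2 hy'₁
        refine ⟨y'', ⟨hy''₁, hy''₂⟩, fun a ha hle => ?_⟩
        obtain ⟨b', hb', hby', hyb'⟩ := hstep' a ha hle
        obtain ⟨b, hb, hby, hyb⟩ := hstep b' hb' hby'
        refine ⟨b, hb, hby, ?_⟩
        calc y - b ≤ y ^ 2 * (y' - b') := hyb
          _ ≤ y ^ 2 * (y' ^ 2 * (y'' - a)) := mul_le_mul_of_nonneg_left hyb' (sq_nonneg y)
          _ = (y * y') ^ 2 * (y'' - a) := by ring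
          _ ≤ max (β ^ 2) (c ^ 2) * (y'' - a) :=
            mul_le_mul_of_nonneg_right
              ((pow_le_pow_left₀ (by positivity) hyy 2).trans (le_max_right _ _)) (by linarith)
  obtain ⟨k, hk⟩ := exists_nat_sub_mul_mem hp (show α ≤ lam by linarith)
  intro η hη
  obtain ⟨a, ha, h₁, h₂⟩ := hsub ⟨hk.1, hk.2⟩ η hη
  exact ⟨lam - k * p - a, by linarith, by linarith, (rootValue_sub_nat_mul_inv hlam k).sub ha⟩

end Caterpillars

section Triangles

/-- A map with fixed point `l` that contracts `[x₀, l]` has no gap longer than `F x₀ - x₀`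
in the orbit of `x₀`. -/
theorem exists_iterate_le_and_le_add {F : ℝ → ℝ} {x₀ l κ v : ℝ} (hκ0 : 0 ≤ κ) (hκ1 : κ < 1)
    (hF : ∀ x y, x₀ ≤ x → x ≤ y → y ≤ l → F x ≤ F y ∧ F y - F x ≤ κ * (y - x))
    (hl : F l = l) (h0 : x₀ ≤ F x₀) (hv : x₀ ≤ v) (hvl : v < l) :
    ∃ n : ℕ, F^[n] x₀ ≤ v ∧ v ≤ F^[n] x₀ + (F x₀ - x₀) := by
  have hx₀l : x₀ ≤ l := hv.trans hvl.le
  have hmem : ∀ n : ℕ, x₀ ≤ F^[n] x₀ ∧ F^[n] x₀ ≤ l ∧ l - F^[n] x₀ ≤ κ ^ n * (l - x₀) := by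
    intro n
    induction n with
    | zero => simp [hx₀l]
    | succ n ih =>
      obtain ⟨h₁, h₂, h₃⟩ := ih
      rw [Function.iterate_succ_apply']
      have h₄ := hF _ _ le_rfl h₁ h₂
      have h₅ := hF _ _ h₁ h₂ le_rfl
      rw [hl] at h₅
      refine ⟨h0.trans h₄.1, h₅.1, h₅.2.trans ?_⟩
      rw [pow_succ', mul_assoc]
      exact mul_le_mul_of_nonneg_left h₃ hκ0
  refine exists_le_and_le_add (l := l) (fun η hη => ?_) (fun n => ?_) hv hvl
  · obtain ⟨n, hn⟩ := exists_pow_lt_of_lt_one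
      (show 0 < η / (l - x₀ + 1) from div_pos hη (by linarith)) hκ1
    rw [lt_div_iff₀ (by linarith)] at hn
    have h₁ := (hmem n).2.2
    have h₂ : 0 ≤ κ ^ n := pow_nonneg hκ0 n
    exact ⟨n, by nlinarith⟩
  · obtain ⟨h₁, h₂, -⟩ := hmem n
    rw [Function.iterate_succ_apply']
    have h₃ := (hF _ _ le_rfl h₁ h₂).2
    nlinarith

/-- In terms of the ratios `w` for which `w / (1 + w)` is a branch value, the effect of joining a
new vertex to two adjacent branches whose ratios sum to `s`. -/
noncomputable def coneStep (N s : ℝ) : ℝ := N * (1 + s) / (N + 1 + s)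

theorem coneStep_mono {N s s' : ℝ} (hN : 0 < N) (hs' : 0 ≤ s') (h : s' ≤ s) :
    coneStep N s' ≤ coneStep N s := by
  unfold coneStep
  rw [div_le_div_iff₀ (by linarith) (by linarith)]
  nlinarith [mul_nonneg (mul_pos hN hN).le (sub_nonneg.2 h)]

theorem coneStep_sub_le {N s s' : ℝ} (hN : 0 < N) (hs' : 0 ≤ s') (h : s' ≤ s) :
    coneStep N s - coneStep N s' ≤ N / (N + 1) * (s - s') := by
  have h₁ : coneStep N s - coneStep N s' = N ^ 2 / ((N + 1 + s) * (N + 1 + s')) * (s - s') := by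
    unfold coneStep
    have : N + 1 + s ≠ 0 := by linarith
    have : N + 1 + s' ≠ 0 := by linarith
    field_simp
    ring
  rw [h₁]
  refine mul_le_mul_of_nonneg_right ?_ (by linarith)
  have hs : 0 ≤ s := hs'.trans h
  rw [div_le_div_iff₀ (by positivity) (by positivity)]
  have h₂ : 0 ≤ N * (N * s + s' * (N + 1 + s) + N + 1 + s) := by positivity
  nlinarith

theorem exists_coneStep_eq {N a b v : ℝ} (hN : 0 < N) (ha : 0 ≤ a) (hab : a ≤ b)
    (h₁ : coneStep N a ≤ v) (h₂ : v ≤ coneStep N b) :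
    ∃ s, a ≤ s ∧ s ≤ b ∧ coneStep N s = v := by
  have hc : ContinuousOn (coneStep N) (Set.Icc a b) := by
    unfold coneStep
    refine ContinuousOn.div (by fun_prop) (by fun_prop) fun x hx => ?_
    have := hx.1
    linarith
  obtain ⟨s, hs, h⟩ := intermediate_value_Icc hab hc ⟨h₁, h₂⟩
  exact ⟨s, hs.1, hs.2, h⟩

/-- A set of ratios that contains `0` and is closed under joining new vertices. -/
def IsConeClosed (N : ℝ) (S : Set ℝ) : Prop :=
  0 ∈ S ∧ (∀ w ∈ S, 0 ≤ w) ∧ ∀ a ∈ S, ∀ b ∈ S, coneStep N (a + b) ∈ S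

theorem isConeClosed_setOf_isBranch {N lam : ℝ} (hN : 0 < N) (hlam : lam = 2 + 1 / N) :
    IsConeClosed N {w | 0 ≤ w ∧ IsBranch lam (w / (1 + w))} := by
  refine ⟨⟨le_rfl, Or.inl (by simp)⟩, fun w hw => hw.1, ?_⟩
  rintro a ⟨ha, ha'⟩ b ⟨hb, hb'⟩
  have hr : RootValue lam (lam - (a + b) / (1 + (a + b))) := by
    rcases ha.eq_or_lt with rfl | ha0
    · simpa using (rootValue_self lam).sub hb'
    rcases hb.eq_or_lt with rfl | hb0
    · simpa using (rootValue_self lam).sub ha'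
    have hA : RootValue lam (a / (1 + a))⁻¹ := by
      rcases ha' with h | h
      · exact absurd h (by positivity)
      · exact h.2
    have hB : RootValue lam (b / (1 + b))⁻¹ := by
      rcases hb' with h | h
      · exact absurd h (by positivity)
      · exact h.2
    have hA1 : 1 < (a / (1 + a))⁻¹ := by
      rw [inv_div, lt_div_iff₀ ha0]
      linarith
    have hB1 : 1 < (b / (1 + b))⁻¹ := by
      rw [inv_div, lt_div_iff₀ hb0]
      linarith
    convert hA.triangle hB hA1 hB1 using 2
    have h₁ : (1 + a) / a * ((1 + b) / b) - 1 = (1 + (a + b)) / (a * b) := by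
      field_simp
      ring
    rw [inv_div, inv_div, h₁]
    field_simp
    ring
  have h₁ : (lam - (a + b) / (1 + (a + b)))⁻¹
      = coneStep N (a + b) / (1 + coneStep N (a + b)) := by
    have h₂ : lam - (a + b) / (1 + (a + b))
        = (2 * N + 1 + (N + 1) * (a + b)) / (N * (1 + (a + b))) := by
      rw [hlam]
      field_simp
      ring
    have h₃ : 1 + coneStep N (a + b)
        = (2 * N + 1 + (N + 1) * (a + b)) / (N + 1 + (a + b)) := by
      unfold coneStep
      field_simp
      ring
    rw [h₂, h₃]
    unfold coneStep
    field_simp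
  have h₀ : 0 < coneStep N (a + b) := by
    unfold coneStep
    positivity
  refine ⟨h₀.le, ?_⟩
  rw [← h₁]
  refine hr.isBranch_inv (inv_pos.1 ?_)
  rw [h₁]
  positivity

theorem IsConeClosed.of_approxBelow {N : ℝ} {S : Set ℝ} (hS : IsConeClosed N S) (hN : 0 < N) :
    IsConeClosed N (approxBelow S) := by
  obtain ⟨h0, hnn, hcl⟩ := hS
  have hnn' : ∀ w ∈ approxBelow S, 0 ≤ w := by
    intro w hw
    obtain ⟨a, ha, hle, -⟩ := hw 1 one_pos
    exact (hnn a ha).trans hle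
  refine ⟨subset_approxBelow S h0, hnn', ?_⟩
  intro a ha b hb η hη
  obtain ⟨a', ha', h₁, h₂⟩ := ha (η / 2) (by linarith)
  obtain ⟨b', hb', h₃, h₄⟩ := hb (η / 2) (by linarith)
  have h₅ : 0 ≤ a' + b' := add_nonneg (hnn _ ha') (hnn _ hb')
  refine ⟨_, hcl a' ha' b' hb', coneStep_mono hN h₅ (by linarith), ?_⟩
  have h₆ := coneStep_sub_le hN h₅ (show a' + b' ≤ a + b by linarith)
  have h₇ : N / (N + 1) * (a + b - (a' + b')) ≤ 1 * (a + b - (a' + b')) := by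
    refine mul_le_mul_of_nonneg_right ?_ (by linarith)
    rw [div_le_one (by linarith)]
    linarith
  linarith

theorem IsConeClosed.iterate_mem {N : ℝ} {S : Set ℝ} (hS : IsConeClosed N S) (n : ℕ) :
    (coneStep N)^[n] 0 ∈ S := by
  induction n with
  | zero => exact hS.1
  | succ n ih =>
    rw [Function.iterate_succ_apply']
    simpa using hS.2.2 _ ih 0 hS.1

theorem coneStep_fixed {u N : ℝ} (hu : 0 < u) (hN : N = u * (u + 1)) : coneStep N u = u := by
  subst hN
  unfold coneStep
  field_simp
  ring

theorem IsConeClosed.fixed_mem {u N : ℝ} {S : Set ℝ} (hS : IsConeClosed N S) (hu : 0 < u)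
    (hN : N = u * (u + 1)) : u ∈ approxBelow S := by
  have hN0 : 0 < N := hN ▸ by positivity
  refine subset_approxBelow_of_contraction (I := {u}) (κ := N / (N + 1)) (M := u)
    (by positivity) ((div_lt_one (by linarith)).2 (by linarith))
    (by rintro _ rfl; exact ⟨hu.le, le_rfl⟩) hS.1 ?_ rfl
  rintro _ rfl
  refine ⟨_, rfl, fun a ha hle => ⟨coneStep N a, by simpa using hS.2.2 a ha 0 hS.1, ?_, ?_⟩⟩
  · conv_rhs => rw [← coneStep_fixed hu hN]
    exact coneStep_mono hN0 (hS.2.1 a ha) hle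
  · conv_lhs => rw [← coneStep_fixed hu hN]
    exact coneStep_sub_le hN0 (hS.2.1 a ha) hle

theorem IsConeClosed.exists_sub_mem_Icc {u N s : ℝ} {S : Set ℝ} (hS : IsConeClosed N S)
    (hu : 0 < u) (hN : N = u * (u + 1)) (h₁ : u ≤ s) (h₂ : s ≤ 2 * u + 1) :
    ∃ w ∈ approxBelow S, u ≤ s - w ∧ s - w ≤ u + 1 := by
  have hN0 : 0 < N := hN ▸ by positivity
  rcases lt_or_ge s (2 * u) with h | h
  · obtain ⟨n, hn₁, hn₂⟩ := exists_iterate_le_and_le_add (F := coneStep N) (x₀ := 0) (l := u)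
      (κ := N / (N + 1)) (v := s - u) (by positivity)
      ((div_lt_one (by linarith)).2 (by linarith))
      (fun x y hx hxy _ => ⟨coneStep_mono hN0 hx hxy, coneStep_sub_le hN0 hx hxy⟩)
      (coneStep_fixed hu hN) (by unfold coneStep; positivity) (by linarith) (by linarith)
    have h₃ : coneStep N 0 ≤ 1 := by
      unfold coneStep
      rw [div_le_one (by linarith)]
      linarith
    exact ⟨_, subset_approxBelow S (hS.iterate_mem n), by linarith, by linarith⟩
  · exact ⟨u, hS.fixed_mem hu hN, by linarith, by linarith⟩

theorem IsConeClosed.Icc_add_one_subset {u N : ℝ} {S : Set ℝ} (hS : IsConeClosed N S)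
    (hu : 2 ≤ u) (hN : N = u * (u + 1)) : Set.Icc u (u + 1) ⊆ approxBelow S := by
  have hN0 : 0 < N := hN ▸ by positivity
  have hL := hS.of_approxBelow hN0
  refine Set.Subset.trans ?_ (approxBelow_approxBelow_subset S)
  refine subset_approxBelow_of_contraction (κ := N / (N + 1)) (M := u + 1)
    (by positivity) ((div_lt_one (by linarith)).2 (by linarith))
    (fun v hv => ⟨by linarith [hv.1], hv.2⟩) hL.1 ?_
  rintro v ⟨hv₁, hv₂⟩
  have hend : u + 1 ≤ coneStep N (2 * u + 1) := by
    unfold coneStep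
    rw [le_div_iff₀ (by linarith)]
    subst hN
    nlinarith [mul_nonneg (sq_nonneg (u + 1)) (sub_nonneg.2 hu)]
  obtain ⟨s, hs₁, hs₂, rfl⟩ := exists_coneStep_eq (a := u) (b := 2 * u + 1) hN0 (by linarith)
    (by linarith) (by rwa [coneStep_fixed (by linarith) hN]) (hv₂.trans hend)
  obtain ⟨w, hw, hw₁, hw₂⟩ := hS.exists_sub_mem_Icc (by linarith) hN hs₁ hs₂
  refine ⟨s - w, ⟨hw₁, hw₂⟩, fun a ha hle => ⟨_, hL.2.2 a ha w hw, ?_, ?_⟩⟩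
  · exact coneStep_mono hN0 (add_nonneg (hL.2.1 a ha) (hL.2.1 w hw)) (by linarith)
  · have := coneStep_sub_le hN0 (add_nonneg (hL.2.1 a ha) (hL.2.1 w hw))
      (show a + w ≤ s by linarith)
    rwa [← sub_sub, sub_right_comm] at this

theorem IsConeClosed.Icc_coneStep_subset {u N b : ℝ} {S : Set ℝ} (hS : IsConeClosed N S)
    (hu : 2 ≤ u) (hN : N = u * (u + 1)) (hb : u + 1 ≤ b)
    (hsub : Set.Icc u b ⊆ approxBelow S) :
    Set.Icc u (coneStep N (2 * b)) ⊆ approxBelow S := by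
  have hN0 : 0 < N := hN ▸ by positivity
  have hL := hS.of_approxBelow hN0
  rintro v ⟨hv₁, hv₂⟩
  obtain ⟨s, hs₁, hs₂, rfl⟩ := exists_coneStep_eq (a := u) (b := 2 * b) hN0 (by linarith)
    (by linarith) (by rwa [coneStep_fixed (by linarith) hN]) hv₂
  rcases le_or_gt (2 * u) s with h | h
  · have hh : s / 2 ∈ approxBelow S := hsub ⟨by linarith, by linarith⟩
    simpa using hL.2.2 _ hh _ hh
  · obtain ⟨w, hw, hw₁, hw₂⟩ := hS.exists_sub_mem_Icc (by linarith) hN hs₁ (by linarith)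
    have hh : s - w ∈ approxBelow S := hsub ⟨hw₁, hw₂.trans hb⟩
    simpa using hL.2.2 _ hh _ hw

theorem IsConeClosed.Icc_half_subset {u N : ℝ} {S : Set ℝ} (hS : IsConeClosed N S)
    (hu : 2 ≤ u) (hN : N = u * (u + 1)) : Set.Icc u (N / 2) ⊆ approxBelow S := by
  have huN : u + 1 ≤ N / 2 := by nlinarith
  have key : ∀ n : ℕ, Set.Icc u (min (N / 2) (u + 1 + n / 6)) ⊆ approxBelow S := by
    intro n
    induction n with
    | zero =>
      refine Set.Subset.trans (Set.Icc_subset_Icc_right ?_) (hS.Icc_add_one_subset hu hN)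
      simp
    | succ n ih =>
      set b := min (N / 2) (u + 1 + n / 6) with hb
      have hb₁ : u + 1 ≤ b := le_min huN (by linarith [n.cast_nonneg (α := ℝ)])
      have hb₂ : b ≤ N / 2 := min_le_left _ _
      refine Set.Subset.trans (Set.Icc_subset_Icc_right ?_)
        (hS.Icc_coneStep_subset hu hN hb₁ ih)
      have h₁ : b + 1 / 6 ≤ coneStep N (2 * b) := by
        unfold coneStep
        rw [le_div_iff₀ (by linarith)]
        nlinarith [mul_nonneg (show 0 ≤ b by linarith) (sub_nonneg.2 hb₂)]
      refine le_trans ?_ h₁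
      rw [hb, ← min_add_add_right]
      refine min_le_min (by linarith) ?_
      push_cast
      linarith
  rintro v ⟨hv₁, hv₂⟩
  obtain ⟨n, hn⟩ := exists_nat_gt (N * 6)
  exact key n ⟨hv₁, le_min hv₂ (by linarith)⟩

theorem mem_approxBelow_isBranch {lam y w : ℝ} (hw0 : 0 ≤ w) (hy : y = w / (1 + w))
    (hw : w ∈ approxBelow {w | 0 ≤ w ∧ IsBranch lam (w / (1 + w))}) :
    y ∈ approxBelow {y | IsBranch lam y} := by
  intro η hη
  obtain ⟨a, ⟨ha0, ha⟩, h₁, h₂⟩ := hw η hη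
  have h₃ : y - a / (1 + a) = (w - a) / ((1 + w) * (1 + a)) := by
    rw [hy]
    field_simp
    ring
  have h₄ : 0 ≤ (w - a) / ((1 + w) * (1 + a)) := div_nonneg (by linarith) (by positivity)
  have h₅ : (w - a) / ((1 + w) * (1 + a)) ≤ w - a := by
    refine div_le_self (by linarith) ?_
    nlinarith [mul_nonneg hw0 ha0]
  exact ⟨_, ha, by linarith, by linarith⟩

theorem exists_rootValue_of_add_eq {lam y₁ y₂ y₃ : ℝ}
    (h₁ : y₁ ∈ approxBelow {y | IsBranch lam y}) (h₂ : y₂ ∈ approxBelow {y | IsBranch lam y})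
    (h₃ : y₃ ∈ approxBelow {y | IsBranch lam y}) (h : y₁ + y₂ + y₃ = lam) :
    ∀ η > 0, ∃ r, 0 ≤ r ∧ r < η ∧ RootValue lam r := by
  intro η hη
  obtain ⟨a, ha, ha₁, ha₂⟩ := h₁ (η / 3) (by linarith)
  obtain ⟨b, hb, hb₁, hb₂⟩ := h₂ (η / 3) (by linarith)
  obtain ⟨c, hc, hc₁, hc₂⟩ := h₃ (η / 3) (by linarith)
  exact ⟨lam - a - b - c, by linarith, by linarith, (((rootValue_self lam).sub ha).sub hb).sub hc⟩

theorem lt_seven_of_pow_lt {u : ℝ} (h : u ^ 4 * (u + 1) ^ 2 + u ^ 6 < (u + 1) ^ 6) : u < 7 := by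
  by_contra! hu
  obtain ⟨s, rfl⟩ : ∃ s, u = 7 + s := ⟨u - 7, by ring⟩
  have hs : 0 ≤ s := by linarith
  have h₁ : (7 + s) ^ 4 * (7 + s + 1) ^ 2 + (7 + s) ^ 6 - (7 + s + 1) ^ 6
      = s ^ 6 + 38 * s ^ 5 + 581 * s ^ 4 + 4488 * s ^ 3 + 17744 * s ^ 2 + 30458 * s + 9169 := by
    ring
  have : 0 ≤ s ^ 6 + 38 * s ^ 5 + 581 * s ^ 4 + 4488 * s ^ 3 + 17744 * s ^ 2 + 30458 * s := by
    positivity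
  linarith

theorem triangle_bound_sub {u N : ℝ} (hu : 0 < u) (hN : N = u * (u + 1)) :
    N / (N + 2) - u / (u + 1) = u * (u - 1) / ((N + 2) * (u + 1)) := by
  have : 0 < N := hN ▸ by positivity
  field_simp
  rw [hN]
  ring

/-- The first two one-vertex extensions of the empty branch are close together. -/
theorem second_sub_first_le {u N : ℝ} (h2 : 2 ≤ u) (h7 : u ≤ 7) (hN : N = u * (u + 1)) :
    N * (2 * N + 1) / ((N + 1) * (3 * N + 1)) - N / (2 * N + 1)
      ≤ 2 * (N / (N + 2) - u / (u + 1)) := by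
  have hu : 0 < u := by linarith
  have hN0 : 0 < N := hN ▸ by positivity
  have h₁ : N * (2 * N + 1) / ((N + 1) * (3 * N + 1)) - N / (2 * N + 1)
      = N ^ 3 / ((2 * N + 1) * (N + 1) * (3 * N + 1)) := by
    field_simp
    ring
  have h₂ : N ^ 3 / ((2 * N + 1) * (N + 1) * (3 * N + 1)) ≤ N / (6 * N + 11) := by
    rw [div_le_div_iff₀ (by positivity) (by positivity)]
    have : 0 ≤ N * (6 * N + 1) := by positivity
    linarith
  have h₃ : N / (6 * N + 11) ≤ 2 * (u * (u - 1) / ((N + 2) * (u + 1))) := by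
    rw [← mul_div_assoc, div_le_div_iff₀ (by positivity) (by positivity)]
    have h₄ : (u + 1) ^ 2 * (N + 2) ≤ 2 * (u - 1) * (6 * N + 11) := by
      rw [hN]
      nlinarith [mul_nonneg (mul_nonneg (sub_nonneg.2 h2) (sub_nonneg.2 h7))
        (show 0 ≤ u ^ 2 - 4 by nlinarith)]
    have h₅ := mul_le_mul_of_nonneg_left h₄ hu.le
    calc N * ((N + 2) * (u + 1)) = u * ((u + 1) ^ 2 * (N + 2)) := by rw [hN]; ring
      _ ≤ u * (2 * (u - 1) * (6 * N + 11)) := h₅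
      _ = 2 * (u * (u - 1)) * (6 * N + 11) := by ring
  rw [triangle_bound_sub hu hN, h₁]
  exact h₂.trans h₃

theorem third_sub_second_le {u N : ℝ} (h2 : 2 ≤ u) (h7 : u ≤ 7) (hN : N = u * (u + 1)) :
    N * (N + 1) * (3 * N + 1) / ((2 * N + 1) * (2 * N ^ 2 + 4 * N + 1))
      - N * (2 * N + 1) / ((N + 1) * (3 * N + 1)) ≤ N / (N + 2) - u / (u + 1) := by
  have hu : 0 < u := by linarith
  have hN0 : 0 < N := hN ▸ by positivity
  have h₁ : N * (N + 1) * (3 * N + 1) / ((2 * N + 1) * (2 * N ^ 2 + 4 * N + 1))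
      - N * (2 * N + 1) / ((N + 1) * (3 * N + 1))
      = N ^ 5 / ((2 * N ^ 2 + 4 * N + 1) * ((2 * N + 1) * (N + 1) * (3 * N + 1))) := by
    field_simp
    ring
  have h₂ : N ^ 5 / ((2 * N ^ 2 + 4 * N + 1) * ((2 * N + 1) * (N + 1) * (3 * N + 1)))
      ≤ N ^ 2 / (2 * (N + 2) * (6 * N + 11)) := by
    rw [div_le_div_iff₀ (by positivity) (by positivity)]
    have h : N ^ 3 * (2 * (N + 2) * (6 * N + 11))
        ≤ (2 * N ^ 2 + 4 * N + 1) * ((2 * N + 1) * (N + 1) * (3 * N + 1)) := by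
      have : 0 ≤ N * (N ^ 2 + N + 1) := by positivity
      nlinarith [pow_pos hN0 3, pow_pos hN0 2]
    have := mul_le_mul_of_nonneg_left h (sq_nonneg N)
    linarith
  have h₃ : N ^ 2 / (2 * (N + 2) * (6 * N + 11)) ≤ u * (u - 1) / ((N + 2) * (u + 1)) := by
    rw [div_le_div_iff₀ (by positivity) (by positivity)]
    have h₄ : u * (u + 1) ^ 3 ≤ 2 * (u - 1) * (6 * N + 11) := by
      rw [hN]
      nlinarith [mul_nonneg (pow_nonneg hu.le 3) (sub_nonneg.2 h7),
        mul_nonneg (sub_nonneg.2 h2) (show 0 ≤ 2 * u ^ 2 + u + 11 by positivity)]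
    have h₅ := mul_le_mul_of_nonneg_left h₄ (show 0 ≤ u * (N + 2) by positivity)
    calc N ^ 2 * ((N + 2) * (u + 1)) = u * (N + 2) * (u * (u + 1) ^ 3) := by rw [hN]; ring
      _ ≤ u * (N + 2) * (2 * (u - 1) * (6 * N + 11)) := h₅
      _ = u * (u - 1) * (2 * (N + 2) * (6 * N + 11)) := by ring
  rw [triangle_bound_sub hu hN, h₁]
  exact h₂.trans h₃

theorem first_add_second_le {u N : ℝ} (hu : 0 < u) (hN : N = u * (u + 1))
    (h : u ^ 4 * (u + 1) ^ 2 + u ^ 6 < (u + 1) ^ 6) :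
    N / (2 * N + 1) + N * (2 * N + 1) / ((N + 1) * (3 * N + 1)) ≤ (u + 1) / u := by
  have hN0 : 0 < N := hN ▸ by positivity
  have h₁ : N / (2 * N + 1) + N * (2 * N + 1) / ((N + 1) * (3 * N + 1))
      = (7 * N ^ 3 + 8 * N ^ 2 + 2 * N) / ((2 * N + 1) * (N + 1) * (3 * N + 1)) := by
    field_simp
    ring
  rw [h₁, div_le_div_iff₀ (by positivity) hu]
  have h₂ := mul_nonneg (show 0 ≤ u + 1 by linarith) (sub_nonneg.2 h.le)
  have h₃ : (u + 1) * ((2 * N + 1) * (N + 1) * (3 * N + 1)) - (7 * N ^ 3 + 8 * N ^ 2 + 2 * N) * u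
      = (u + 1) * ((u + 1) ^ 6 - (u ^ 4 * (u + 1) ^ 2 + u ^ 6)) := by
    rw [hN]
    ring
  linarith

theorem le_second_add_triangle_bound {N : ℝ} (hN : 117 / 16 ≤ N) :
    2 + 1 / N ≤ N * (2 * N + 1) / ((N + 1) * (3 * N + 1)) + 2 * (N / (N + 2)) := by
  have hN0 : 0 < N := by linarith
  have h₁ : N * (2 * N + 1) / ((N + 1) * (3 * N + 1)) + 2 * (N / (N + 2)) - (2 + 1 / N)
      = (2 * N ^ 4 - 10 * N ^ 3 - 24 * N ^ 2 - 13 * N - 2)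
        / ((N + 1) * (3 * N + 1) * (N + 2) * N) := by
    field_simp
    ring
  have h₂ : 4 ≤ N ^ 2 - 5 * N - 12 := by nlinarith
  have h₃ : 0 ≤ N * (2 * N * (N ^ 2 - 5 * N - 12 - 4)) :=
    mul_nonneg hN0.le (mul_nonneg (by linarith) (by linarith))
  have h₄ : 0 ≤ 2 * N ^ 4 - 10 * N ^ 3 - 24 * N ^ 2 - 13 * N - 2 := by nlinarith
  have h₅ := div_nonneg h₄ (show 0 ≤ (N + 1) * (3 * N + 1) * (N + 2) * N by positivity)
  linarith

theorem exists_rootValue_of_pow_lt {lam u N : ℝ} (hu : 2 ≤ u) (hN : N = u * (u + 1))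
    (hlam : lam = 2 + 1 / N) (h : u ^ 4 * (u + 1) ^ 2 + u ^ 6 < (u + 1) ^ 6) :
    ∀ η > 0, ∃ r, 0 ≤ r ∧ r < η ∧ RootValue lam r := by
  have hu0 : 0 < u := by linarith
  have hu7 := (lt_seven_of_pow_lt h).le
  have hN6 : 6 ≤ N := by nlinarith
  have hN0 : 0 < N := by linarith
  have hI : ∀ y, u / (u + 1) ≤ y → y ≤ N / (N + 2) → y ∈ approxBelow {y | IsBranch lam y} := by
    intro y hy₁ hy₂
    have hy1 : y < 1 := hy₂.trans_lt ((div_lt_one (by linarith)).2 (by linarith))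
    have hy0 : 0 < 1 - y := by linarith
    rw [div_le_iff₀ (by linarith)] at hy₁
    rw [le_div_iff₀ (by linarith)] at hy₂
    have hw : u ≤ y / (1 - y) := by
      rw [le_div_iff₀ hy0]
      linarith
    refine mem_approxBelow_isBranch (w := y / (1 - y)) (hu0.le.trans hw) ?_
      ((isConeClosed_setOf_isBranch hN0 hlam).Icc_half_subset hu hN ⟨hw, ?_⟩)
    · field_simp
      ring
    · rw [div_le_iff₀ hy0]
      linarith
  have ht : lam - u / (u + 1) = (u + 1) / u := by
    rw [hlam, hN]
    field_simp
    ring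
  have ha := second_sub_first_le hu hu7 hN
  have hb := third_sub_second_le hu hu7 hN
  have hb₀ := first_add_second_le hu0 hN h
  have e₁ : (lam - 0)⁻¹ = N / (2 * N + 1) := by
    have : lam - 0 = (2 * N + 1) / N := by
      rw [hlam]
      field_simp
      ring
    rw [this, inv_div]
  have e₂ : (lam - N / (2 * N + 1))⁻¹ = N * (2 * N + 1) / ((N + 1) * (3 * N + 1)) := by
    have : lam - N / (2 * N + 1) = (N + 1) * (3 * N + 1) / (N * (2 * N + 1)) := by
      rw [hlam]
      field_simp
      ring
    rw [this, inv_div]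
  have e₃ : (lam - N * (2 * N + 1) / ((N + 1) * (3 * N + 1)))⁻¹
      = N * (N + 1) * (3 * N + 1) / ((2 * N + 1) * (2 * N ^ 2 + 4 * N + 1)) := by
    have : lam - N * (2 * N + 1) / ((N + 1) * (3 * N + 1))
        = (2 * N + 1) * (2 * N ^ 2 + 4 * N + 1) / (N * (N + 1) * (3 * N + 1)) := by
      rw [hlam]
      field_simp
      ring
    rw [this, inv_div]
  have hlam2 : 2 < lam := by
    rw [hlam]
    have : 0 < 1 / N := by positivity
    linarith
  have hq1 : u / (u + 1) < 1 := (div_lt_one (by linarith)).2 (by linarith)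
  have hstep : ∀ y, y ≤ u / (u + 1) → IsBranch lam y → IsBranch lam (lam - y)⁻¹ := fun y hy hy' =>
    ((rootValue_self lam).sub hy').isBranch_inv (by linarith)
  have hc₁ : IsBranch lam (N / (2 * N + 1)) := by
    rw [← e₁]
    exact hstep 0 (by positivity) (Or.inl rfl)
  have hc₁q : N / (2 * N + 1) ≤ u / (u + 1) := by
    rw [div_le_div_iff₀ (by positivity) (by positivity)]
    nlinarith
  have hc₂ : IsBranch lam (N * (2 * N + 1) / ((N + 1) * (3 * N + 1))) := by
    rw [← e₂]
    exact hstep _ hc₁q hc₁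
  rcases lt_or_ge lam (N / (2 * N + 1) + 2 * (u / (u + 1))) with hcase | hcase
  · set q := u / (u + 1) with hq
    set c₂ := N * (2 * N + 1) / ((N + 1) * (3 * N + 1)) with hc₂def
    have ht1 : 1 < (u + 1) / u := (one_lt_div hu0).2 (by linarith)
    have hqt : ((u + 1) / u)⁻¹ = q := by rw [inv_div]
    have hF : ∀ x y, c₂ ≤ x → x ≤ y → y ≤ q → (lam - x)⁻¹ ≤ (lam - y)⁻¹ ∧
        (lam - y)⁻¹ - (lam - x)⁻¹ ≤ q ^ 2 * (y - x) := by
      intro x y _ hxy hyq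
      have h₁ : 0 < lam - y := by linarith
      have h₂ : 0 < lam - x := by linarith
      refine ⟨inv_anti₀ h₁ (by linarith), ?_⟩
      have h₃ : (lam - y)⁻¹ ≤ q := by
        rw [← hqt, ← ht]
        exact inv_anti₀ (by linarith) (by linarith)
      have h₄ : (lam - x)⁻¹ ≤ q := by
        rw [← hqt, ← ht]
        exact inv_anti₀ (by linarith) (by linarith)
      have h₅ : (lam - y)⁻¹ - (lam - x)⁻¹ = (lam - y)⁻¹ * (lam - x)⁻¹ * (y - x) := by
        field_simp
        ring
      rw [h₅, sq]
      refine mul_le_mul_of_nonneg_right ?_ (by linarith)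
      exact mul_le_mul h₃ h₄ (inv_pos.2 h₂).le (by positivity)
    have hcc : c₂ ≤ (lam - c₂)⁻¹ := by
      rw [e₃, hc₂def, div_le_div_iff₀ (by positivity) (by positivity)]
      have : 0 ≤ N ^ 5 := by positivity
      nlinarith
    have hv : c₂ ≤ lam - N / (2 * N + 1) - q := by linarith
    obtain ⟨n, hn₁, hn₂⟩ := exists_iterate_le_and_le_add (F := fun y => (lam - y)⁻¹) (x₀ := c₂)
      (l := q) (κ := q ^ 2) (v := lam - N / (2 * N + 1) - q) (sq_nonneg q)
      (by nlinarith [show 0 < q by positivity]) hF (by simp only [ht, hqt]) hcc hv (by linarith)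
    have hbr : ∀ n : ℕ, IsBranch lam ((fun y => (lam - y)⁻¹)^[n] c₂) ∧
        (fun y => (lam - y)⁻¹)^[n] c₂ ≤ q := by
      intro n
      induction n with
      | zero => exact ⟨hc₂, by simp only [Function.iterate_zero, id]; linarith⟩
      | succ n ih =>
        rw [Function.iterate_succ_apply']
        refine ⟨hstep _ ih.2 ih.1, ?_⟩
        rw [← hqt, ← ht]
        exact inv_anti₀ (by linarith) (by linarith [ih.2])
    simp only [e₃] at hn₂
    exact exists_rootValue_of_add_eq (subset_approxBelow _ hc₁) (subset_approxBelow _ (hbr n).1)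
      (hI (lam - N / (2 * N + 1) - (fun y => (lam - y)⁻¹)^[n] c₂) (by linarith) (by linarith))
      (by ring)
  · rcases le_or_gt lam (N / (2 * N + 1) + 2 * (N / (N + 2))) with hβ₁ | hβ₁
    · have hm := hI ((lam - N / (2 * N + 1)) / 2) (by linarith) (by linarith)
      exact exists_rootValue_of_add_eq (subset_approxBelow _ hc₁) hm hm (by ring)
    rcases le_or_gt lam (N * (2 * N + 1) / ((N + 1) * (3 * N + 1)) + 2 * (N / (N + 2)))
      with hβ₂ | hβ₂
    · have hm := hI ((lam - N * (2 * N + 1) / ((N + 1) * (3 * N + 1))) / 2)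
        (by linarith) (by linarith)
      exact exists_rootValue_of_add_eq (subset_approxBelow _ hc₂) hm hm (by ring)
    have hu9 : u < 9 / 4 := by
      by_contra! hu9
      have := le_second_add_triangle_bound (show 117 / 16 ≤ N by nlinarith)
      linarith
    have hm : lam / 3 ∈ approxBelow {y | IsBranch lam y} := by
      refine hI _ ?_ ?_
      · have h₁ : lam = (2 * u ^ 2 + 2 * u + 1) / (u * (u + 1)) := by
          rw [hlam, hN]
          field_simp
        rw [h₁, div_div, div_le_div_iff₀ (by positivity) (by positivity)]
        have h₂ : 0 ≤ (u + 1) * (1 + 2 * u - u ^ 2) :=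
          mul_nonneg (by linarith) (by nlinarith)
        nlinarith
      · have h₁ : lam = (2 * N + 1) / N := by
          rw [hlam]
          field_simp
        rw [h₁, div_div, div_le_div_iff₀ (by positivity) (by positivity)]
        nlinarith
    exact exists_rootValue_of_add_eq hm hm hm (by ring)

end Triangles

theorem exists_rootValue_of_lt {ρ lam : ℝ} (hρ : ρ ^ 3 = ρ + 1) (h : √ρ + (√ρ)⁻¹ < lam)
    (hlt : lam < 13 / 6) : ∀ η > 0, ∃ r, 0 ≤ r ∧ r < η ∧ RootValue lam r := by
  have hρ1 : 1 < ρ := by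
    by_contra! hle
    rcases le_or_gt ρ 0 with h0 | h0
    · nlinarith [mul_nonneg (sq_nonneg (ρ + 1)) (neg_nonneg.2 h0), sq_nonneg (ρ + 1)]
    · nlinarith [mul_nonneg h0.le (sub_nonneg.2 hle), mul_nonneg (sq_nonneg ρ) (sub_nonneg.2 hle)]
  have hr : 1 < √ρ := Real.lt_sqrt_of_sq_lt (by simpa using hρ1)
  have hr0 : 0 < √ρ := by linarith
  have hrsq : √ρ ^ 2 = ρ := Real.sq_sqrt (by linarith)
  generalize √ρ = r at *
  have hlam2 : 2 < lam := by
    have h₁ : r + r⁻¹ - 2 = (r - 1) ^ 2 / r := by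
      field_simp
      ring
    have : 0 ≤ (r - 1) ^ 2 / r := by positivity
    linarith
  have hd : 0 < lam - 2 := by linarith
  obtain ⟨u, hu0, hu⟩ : ∃ u : ℝ, 0 < u ∧ u * (u + 1) = 1 / (lam - 2) := by
    have h4 : 0 < 4 / (lam - 2) := by positivity
    have h₁ : 1 < √(1 + 4 / (lam - 2)) := Real.lt_sqrt_of_sq_lt (by linarith)
    have h₂ := Real.sq_sqrt (show 0 ≤ 1 + 4 / (lam - 2) by linarith)
    refine ⟨(√(1 + 4 / (lam - 2)) - 1) / 2, by linarith, ?_⟩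
    have h₃ : 4 / (lam - 2) = 4 * (1 / (lam - 2)) := by ring
    linear_combination (h₂ + h₃) / 4
  have h6 : 6 < u * (u + 1) := by
    rw [hu, lt_div_iff₀ hd]
    linarith
  have hlam : lam = 2 + 1 / (u * (u + 1)) := by
    rw [hu, one_div_one_div]
    ring
  refine exists_rootValue_of_pow_lt (by nlinarith) rfl hlam ?_
  have hlt' : lam = (u + 1) / u + ((u + 1) / u)⁻¹ := by
    rw [hlam]
    field_simp
    ring
  have ht1 : 1 < (u + 1) / u := (one_lt_div hu0).2 (by linarith)
  have htu : (u + 1) / u * u = u + 1 := by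
    field_simp
  generalize (u + 1) / u = t at *
  have hrt : r < t := by
    by_contra! hle
    have h₁ : r + r⁻¹ - (t + t⁻¹) = (r - t) * (r * t - 1) / (r * t) := by
      have : t ≠ 0 := by linarith
      field_simp
      ring
    have h₂ : 0 ≤ (r - t) * (r * t - 1) / (r * t) := by
      refine div_nonneg (mul_nonneg (by linarith) (by nlinarith)) (by positivity)
    linarith
  have hz : ρ < t ^ 2 := by
    rw [← hrsq]
    exact pow_lt_pow_left₀ hrt hr0.le two_ne_zero
  have hz3 : t ^ 2 + 1 < (t ^ 2) ^ 3 := by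
    generalize t ^ 2 = z at *
    have : (z ^ 3 - z - 1) = (z - ρ) * (z ^ 2 + z * ρ + ρ ^ 2 - 1) := by linear_combination hρ
    have h₁ : 0 < (z - ρ) * (z ^ 2 + z * ρ + ρ ^ 2 - 1) :=
      mul_pos (by linarith) (by nlinarith)
    linarith
  rw [← htu]
  have := mul_lt_mul_of_pos_right hz3 (pow_pos hu0 6)
  linarith

/-- The set of smallest adjacency eigenvalues attained by finite simple graphs with
chromatic number at most `3` is dense in `(-∞, -λ*)`, where `λ* = √ρ + 1/√ρ` and `ρ`
is the unique real root of `x³ = x + 1`. -/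
theorem dense_lam1_three_colorable (ρ : ℝ) (hρ : ρ ^ 3 = ρ + 1)
    (lamStar : ℝ) (hlamStar : lamStar = Real.sqrt ρ + (Real.sqrt ρ)⁻¹) :
    Set.Iio (-lamStar) ⊆
      closure {t : ℝ | ∃ (n : ℕ) (G : SimpleGraph (Fin n)),
        G.chromaticNumber ≤ 3 ∧ lam1 G = t} := by
  intro x hx
  rw [Set.mem_Iio] at hx
  rw [← neg_neg x]
  rcases le_or_gt (13 / 6) (-x) with h | h
  · exact mem_closure_of_rootValue (exists_rootValue_of_ge h)
  · exact mem_closure_of_rootValue (exists_rootValue_of_lt hρ (by linarith) h)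
end

section
/- For every real λ ≥ λ' and every ε > 0, there exists a caterpillar tree G such that λ₁(G) lies in the open interval (-λ - ε, -λ). -/
/-- `G` is a caterpillar tree: a tree containing a path such that every vertex is within
distance `1` of that path. -/
def IsCaterpillar {n : ℕ} (G : SimpleGraph (Fin n)) : Prop :=
  G.IsTree ∧ ∃ (u v : Fin n) (p : G.Walk u v), p.IsPath ∧
    ∀ w, ∃ z ∈ p.support, w = z ∨ G.Adj w z


/-- The graph obtained from `G` by attaching a new vertex `Fin.last n` to the vertex `e`. -/
def attachLeaf {n : ℕ} (G : SimpleGraph (Fin n)) (e : Fin n) : SimpleGraph (Fin (n + 1)) :=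
  G.map Fin.castSuccEmb ⊔ SimpleGraph.edge (Fin.last n) e.castSucc

section attachLeaf

variable {n : ℕ} (G : SimpleGraph (Fin n)) (e : Fin n)

@[simp] lemma attachLeaf_adj_castSucc_castSucc (u v : Fin n) :
    (attachLeaf G e).Adj u.castSucc v.castSucc ↔ G.Adj u v := by
  have h : (G.map Fin.castSuccEmb).Adj u.castSucc v.castSucc ↔ G.Adj u v :=
    SimpleGraph.map_adj_apply (f := Fin.castSuccEmb)
  simpa [attachLeaf, SimpleGraph.edge_adj, Fin.castSucc_ne_last] using h

@[simp] lemma attachLeaf_adj_last_castSucc (v : Fin n) :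
    (attachLeaf G e).Adj (Fin.last n) v.castSucc ↔ v = e := by
  have h : ¬ (G.map Fin.castSuccEmb).Adj (Fin.last n) v.castSucc := by
    rw [SimpleGraph.map_adj]
    rintro ⟨a, -, -, ha, -⟩
    exact Fin.castSucc_ne_last a ha
  rw [attachLeaf, SimpleGraph.sup_adj, or_iff_right h]
  simp [SimpleGraph.edge_adj, Fin.castSucc_ne_last, (Fin.castSucc_ne_last _).symm]

@[simp] lemma attachLeaf_adj_castSucc_last (v : Fin n) :
    (attachLeaf G e).Adj v.castSucc (Fin.last n) ↔ v = e := by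
  rw [SimpleGraph.adj_comm, attachLeaf_adj_last_castSucc]

/-- The inclusion of a graph into the graph with a leaf attached. -/
def attachLeafHom : G →g attachLeaf G e where
  toFun := Fin.castSucc
  map_rel' h := (attachLeaf_adj_castSucc_castSucc G e _ _).2 h

lemma card_edgeSet_attachLeaf :
    Nat.card (attachLeaf G e).edgeSet = Nat.card G.edgeSet + 1 := by
  have hE : (attachLeaf G e).edgeSet =
      insert s(Fin.last n, e.castSucc) (Fin.castSuccEmb.sym2Map '' G.edgeSet) := by
    rw [attachLeaf, SimpleGraph.edgeSet_sup, SimpleGraph.edgeSet_map,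
      SimpleGraph.edgeSet_edge_of_ne (Fin.castSucc_ne_last e).symm, Set.union_comm,
      Set.singleton_union]
  have hnot : s(Fin.last n, e.castSucc) ∉ Fin.castSuccEmb.sym2Map '' G.edgeSet := by
    rintro ⟨z, -, hz⟩
    induction z with
    | _ a b => simp [Fin.castSucc_ne_last] at hz
  rw [Nat.card_coe_set_eq, Nat.card_coe_set_eq, hE,
    Set.ncard_insert_of_notMem hnot (Set.toFinite _),
    Set.ncard_image_of_injective _ (Function.Embedding.injective _)]

lemma isTree_attachLeaf {G : SimpleGraph (Fin n)} (hG : G.IsTree) : (attachLeaf G e).IsTree := by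
  have hreach (w : Fin (n + 1)) : (attachLeaf G e).Reachable e.castSucc w := by
    induction w using Fin.lastCases with
    | last => exact ((attachLeaf_adj_castSucc_last G e e).2 rfl).reachable
    | cast v => exact (hG.connected.preconnected e v).map (attachLeafHom G e)
  have hconn : (attachLeaf G e).Connected :=
    { preconnected := fun u v => (hreach u).symm.trans (hreach v)
      nonempty := ⟨Fin.last n⟩ }
  refine SimpleGraph.isTree_iff_connected_and_card.2 ⟨hconn, ?_⟩
  have := (SimpleGraph.isTree_iff_connected_and_card.1 hG).2
  rw [card_edgeSet_attachLeaf, this, Nat.card_fin, Nat.card_fin]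

@[simp] lemma adjMat_attachLeaf_castSucc_castSucc (u v : Fin n) :
    adjMat (attachLeaf G e) u.castSucc v.castSucc = adjMat G u v := by
  by_cases h : G.Adj u v <;> simp [adjMat, h]

@[simp] lemma adjMat_attachLeaf_castSucc_last (v : Fin n) :
    adjMat (attachLeaf G e) v.castSucc (Fin.last n) = if v = e then 1 else 0 := by
  simp [adjMat]

lemma adjMat_attachLeaf_mulVec_castSucc (x : Fin n → ℝ) (y : ℝ) (v : Fin n) :
    (adjMat (attachLeaf G e)).mulVec (Fin.snoc x y : Fin (n + 1) → ℝ) v.castSucc =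
      (adjMat G).mulVec x v + if v = e then y else 0 := by
  simp [Matrix.mulVec, dotProduct, Fin.sum_univ_castSucc]

lemma adjMat_attachLeaf_mulVec_last (x : Fin n → ℝ) (y : ℝ) :
    (adjMat (attachLeaf G e)).mulVec (Fin.snoc x y : Fin (n + 1) → ℝ) (Fin.last n) = x e := by
  simp [Matrix.mulVec, dotProduct, Fin.sum_univ_castSucc, adjMat]

end attachLeaf

/-- `G` is a caterpillar tree with a dominating path ending at `e`. -/
def IsCaterpillarWithEnd {n : ℕ} (G : SimpleGraph (Fin n)) (e : Fin n) : Prop :=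
  G.IsTree ∧ ∃ (u : Fin n) (p : G.Walk u e), p.IsPath ∧ ∀ w, ∃ z ∈ p.support, w = z ∨ G.Adj w z

lemma IsCaterpillarWithEnd.isCaterpillar {n : ℕ} {G : SimpleGraph (Fin n)} {e : Fin n}
    (h : IsCaterpillarWithEnd G e) : IsCaterpillar G :=
  ⟨h.1, h.2.choose, e, h.2.choose_spec⟩

lemma exists_isPath_attachLeaf {n : ℕ} {G : SimpleGraph (Fin n)} (e : Fin n) {u v : Fin n}
    {p : G.Walk u v} (hp : p.IsPath) :
    ∃ q : (attachLeaf G e).Walk u.castSucc v.castSucc,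
      q.IsPath ∧ q.support = p.support.map Fin.castSucc :=
  ⟨p.map (attachLeafHom G e), hp.map (Fin.castSucc_injective n), p.support_map _⟩

lemma IsCaterpillarWithEnd.attachLeaf_castSucc {n : ℕ} {G : SimpleGraph (Fin n)} {e : Fin n}
    (h : IsCaterpillarWithEnd G e) : IsCaterpillarWithEnd (attachLeaf G e) e.castSucc := by
  obtain ⟨hT, u, p, hp, hdom⟩ := h
  obtain ⟨q, hq, hqs⟩ := exists_isPath_attachLeaf e hp
  refine ⟨isTree_attachLeaf e hT, u.castSucc, q, hq, fun w => ?_⟩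
  rw [hqs]
  induction w using Fin.lastCases with
  | last =>
    exact ⟨e.castSucc, List.mem_map.2 ⟨e, p.end_mem_support, rfl⟩,
      Or.inr ((attachLeaf_adj_last_castSucc G e e).2 rfl)⟩
  | cast v =>
    obtain ⟨z, hz, hvz⟩ := hdom v
    exact ⟨z.castSucc, List.mem_map.2 ⟨z, hz, rfl⟩,
      hvz.imp (congrArg _) (attachLeaf_adj_castSucc_castSucc G e v z).2⟩

lemma IsCaterpillarWithEnd.attachLeaf_last {n : ℕ} {G : SimpleGraph (Fin n)} {e : Fin n}
    (h : IsCaterpillarWithEnd G e) : IsCaterpillarWithEnd (attachLeaf G e) (Fin.last n) := by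
  obtain ⟨hT, u, p, hp, hdom⟩ := h
  have hadj : (attachLeaf G e).Adj e.castSucc (Fin.last n) :=
    (attachLeaf_adj_castSucc_last G e e).2 rfl
  obtain ⟨q, hq, hqs⟩ := exists_isPath_attachLeaf e hp
  refine ⟨isTree_attachLeaf e hT, u.castSucc, q.concat hadj, hq.concat ?_ hadj, fun w => ?_⟩
  · rw [hqs, List.mem_map]
    rintro ⟨z, -, hz⟩
    exact Fin.castSucc_ne_last z hz
  rw [SimpleGraph.Walk.support_concat, hqs]
  induction w using Fin.lastCases with
  | last => exact ⟨Fin.last n, by simp, Or.inl rfl⟩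
  | cast v =>
    obtain ⟨z, hz, hvz⟩ := hdom v
    exact ⟨z.castSucc, List.mem_append_left _ (List.mem_map.2 ⟨z, hz, rfl⟩),
      hvz.imp (congrArg _) (attachLeaf_adj_castSucc_castSucc G e v z).2⟩

/-- Some positive vector satisfies the eigenvalue equation of `G` at `t` away from `e`, with
defect `p` at `e`: when `e` is eliminated last, the last pivot of `t - adjMat G` is `p`. -/
def HasPivot {n : ℕ} (G : SimpleGraph (Fin n)) (e : Fin n) (t p : ℝ) : Prop :=
  ∃ x : Fin n → ℝ, (∀ v, 0 < x v) ∧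
    ∀ v, (adjMat G).mulVec x v = t * x v - if v = e then p * x v else 0

lemma HasPivot.attachLeaf_castSucc {n : ℕ} {G : SimpleGraph (Fin n)} {e : Fin n} {t p : ℝ}
    (ht : 0 < t) (h : HasPivot G e t p) :
    HasPivot (attachLeaf G e) e.castSucc t (p - 1 / t) := by
  obtain ⟨x, hx, hAx⟩ := h
  refine ⟨(Fin.snoc x (x e / t) : Fin (n + 1) → ℝ), fun v => ?_, fun v => ?_⟩
  · induction v using Fin.lastCases with
    | last => simpa using div_pos (hx e) ht
    | cast v => simpa using hx v
  · induction v using Fin.lastCases with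
    | last =>
      rw [adjMat_attachLeaf_mulVec_last, if_neg (Fin.castSucc_ne_last e).symm, Fin.snoc_last]
      field_simp
      ring
    | cast v =>
      rw [adjMat_attachLeaf_mulVec_castSucc, hAx]
      by_cases hv : v = e
      · subst hv
        simp only [if_true, Fin.snoc_castSucc]
        ring
      · simp [hv]

lemma HasPivot.attachLeaf_last {n : ℕ} {G : SimpleGraph (Fin n)} {e : Fin n} {t p : ℝ}
    (hp : 0 < p) (h : HasPivot G e t p) :
    HasPivot (attachLeaf G e) (Fin.last n) t (t - 1 / p) := by
  obtain ⟨x, hx, hAx⟩ := h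
  refine ⟨(Fin.snoc x (p * x e) : Fin (n + 1) → ℝ), fun v => ?_, fun v => ?_⟩
  · induction v using Fin.lastCases with
    | last => simpa using mul_pos hp (hx e)
    | cast v => simpa using hx v
  · induction v using Fin.lastCases with
    | last =>
      rw [adjMat_attachLeaf_mulVec_last, if_pos rfl, Fin.snoc_last]
      field_simp
      ring
    | cast v =>
      rw [adjMat_attachLeaf_mulVec_castSucc, hAx, if_neg (Fin.castSucc_ne_last v)]
      by_cases hv : v = e
      · subst hv
        simp
      · simp [hv]

lemma abs_le_of_mulVec_le {n : ℕ} (G : SimpleGraph (Fin n)) {y : Fin n → ℝ} {μ : ℝ}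
    (hy : ∀ v, 0 < y v) (hAy : ∀ v, (adjMat G).mulVec y v ≤ μ * y v) {t : ℝ} {x : Fin n → ℝ}
    (hx : x ≠ 0) (ht : (adjMat G).mulVec x = t • x) : |t| ≤ μ := by
  obtain ⟨i, hi⟩ := Function.ne_iff.1 hx
  obtain ⟨v, -, hv⟩ := Finset.exists_max_image Finset.univ (fun v => |x v| / y v)
    ⟨i, Finset.mem_univ i⟩
  set c := |x v| / y v with hc
  have hxc (w : Fin n) : |x w| ≤ c * y w := (div_le_iff₀ (hy w)).1 (hv w (Finset.mem_univ w))
  have hvc : |x v| = c * y v := by rw [hc, div_mul_cancel₀ _ (hy v).ne']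
  have hc0 : 0 < c := (div_pos (abs_pos.2 hi) (hy i)).trans_le (hv i (Finset.mem_univ i))
  have hA (u w : Fin n) : 0 ≤ adjMat G u w := by
    simp only [adjMat, Matrix.of_apply]
    split_ifs <;> norm_num
  have key : |t| * (c * y v) ≤ μ * (c * y v) := calc
    |t| * (c * y v) = |∑ w, adjMat G v w * x w| := by
      rw [← hvc, ← abs_mul, ← smul_eq_mul, ← Pi.smul_apply, ← ht, Matrix.mulVec, dotProduct]
    _ ≤ ∑ w, |adjMat G v w * x w| := Finset.abs_sum_le_sum_abs _ _
    _ ≤ ∑ w, adjMat G v w * (c * y w) := by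
      refine Finset.sum_le_sum fun w _ => ?_
      rw [abs_mul, abs_of_nonneg (hA v w)]
      exact mul_le_mul_of_nonneg_left (hxc w) (hA v w)
    _ = c * (adjMat G).mulVec y v := by
      rw [Matrix.mulVec, dotProduct, Finset.mul_sum]
      exact Finset.sum_congr rfl fun w _ => by ring
    _ ≤ c * (μ * y v) := mul_le_mul_of_nonneg_left (hAy v) hc0.le
    _ = μ * (c * y v) := by ring
  exact le_of_mul_le_mul_right key (mul_pos hc0 (hy v))

lemma adjMat_isHermitian {n : ℕ} (G : SimpleGraph (Fin n)) : (adjMat G).IsHermitian := by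
  ext u v
  by_cases h : G.Adj u v <;> simp [adjMat, h, G.adj_comm v u]

lemma exists_eigenvalue_le {n : ℕ} {A : Matrix (Fin n) (Fin n) ℝ} (hA : A.IsHermitian)
    {z : Fin n → ℝ} (hz : z ≠ 0) {c : ℝ} (h : z ⬝ᵥ A.mulVec z ≤ c * (z ⬝ᵥ z)) :
    ∃ t ≤ c, ∃ x : Fin n → ℝ, x ≠ 0 ∧ A.mulVec x = t • x := by
  have hB : (A - c • 1).IsHermitian := hA.sub (by simp [Matrix.IsHermitian])
  have hmul (w : Fin n → ℝ) : (A - c • 1).mulVec w = A.mulVec w - c • w := by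
    rw [Matrix.sub_mulVec, Matrix.smul_mulVec, Matrix.one_mulVec]
  obtain ⟨i, hi⟩ : ∃ i, hB.eigenvalues i ≤ 0 := by
    by_contra! hpos
    have := (hB.posDef_iff_eigenvalues_pos.2 hpos).dotProduct_mulVec_pos hz
    rw [hmul, star_trivial, dotProduct_sub, dotProduct_smul, smul_eq_mul] at this
    linarith
  refine ⟨hB.eigenvalues i + c, by linarith, ⇑(hB.eigenvectorBasis i), fun h0 => ?_, ?_⟩
  · exact hB.eigenvectorBasis.orthonormal.ne_zero i (by ext j; exact congrFun h0 j)
  · have := hB.mulVec_eigenvectorBasis i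
    rw [hmul, sub_eq_iff_eq_add] at this
    rw [this, add_smul]

lemma exists_eigenvalue_le_neg {n : ℕ} {G : SimpleGraph (Fin n)} (hG : G.IsAcyclic) (e : Fin n)
    {x : Fin n → ℝ} {c : ℝ} (hx : ∀ v, 0 < x v) (hAx : ∀ v, c * x v ≤ (adjMat G).mulVec x v) :
    ∃ t ≤ -c, ∃ x : Fin n → ℝ, x ≠ 0 ∧ (adjMat G).mulVec x = t • x := by
  obtain ⟨C⟩ := hG.colorable_two
  set σ : Fin n → ℝ := fun v => if C v = 0 then 1 else -1 with hσ
  have hσσ (v : Fin n) : σ v * σ v = 1 := by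
    simp only [hσ]
    split_ifs <;> norm_num
  have hadj (u v : Fin n) : σ u * (adjMat G u v * (σ v * x v)) = -(adjMat G u v * x v) := by
    by_cases h : G.Adj u v
    · have hne := C.valid h
      have : σ u * σ v = -1 := by
        simp only [hσ]
        split_ifs <;> first | exact absurd (by lia) hne | norm_num
      linear_combination adjMat G u v * x v * this
    · simp [adjMat, h]
  refine exists_eigenvalue_le (adjMat_isHermitian G) (z := fun v => σ v * x v) (fun h0 => ?_) ?_
  · rcases mul_eq_zero.1 (congrFun h0 e) with h | h
    · simpa [h] using hσσ e
    · exact (hx e).ne' h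
  · have hz : (fun v => σ v * x v) ⬝ᵥ (fun v => σ v * x v) = x ⬝ᵥ x :=
      Finset.sum_congr rfl fun v _ => by linear_combination x v * x v * hσσ v
    have hAz : (fun v => σ v * x v) ⬝ᵥ (adjMat G).mulVec (fun v => σ v * x v) =
        -(x ⬝ᵥ (adjMat G).mulVec x) := by
      simp only [dotProduct, Matrix.mulVec, Finset.mul_sum, ← Finset.sum_neg_distrib]
      exact Finset.sum_congr rfl fun u _ => Finset.sum_congr rfl fun v _ => by
        linear_combination x u * hadj u v
    rw [hz, hAz, neg_mul, neg_le_neg_iff, dotProduct, dotProduct, Finset.mul_sum]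
    exact Finset.sum_le_sum fun v _ => by nlinarith [hAx v, hx v]

/-- Some caterpillar has pivot `p` at `lam` and pivot `R` at `mu`, both at the same end. -/
def RealizesPivots (lam mu p R : ℝ) : Prop :=
  ∃ (n : ℕ) (G : SimpleGraph (Fin n)) (e : Fin n),
    IsCaterpillarWithEnd G e ∧ HasPivot G e lam p ∧ HasPivot G e mu R

namespace RealizesPivots

variable {lam mu p R : ℝ}

lemma base (lam mu : ℝ) : RealizesPivots lam mu lam mu := by
  have hpiv (t : ℝ) : HasPivot (⊥ : SimpleGraph (Fin 1)) 0 t t :=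
    ⟨fun _ => 1, fun _ => one_pos, fun v => by
      simp [Matrix.mulVec, dotProduct, adjMat, Subsingleton.elim v 0]⟩
  refine ⟨1, ⊥, 0, ⟨.of_subsingleton, 0, .nil, .nil, fun w => ⟨0, by simp, Or.inl ?_⟩⟩,
    hpiv lam, hpiv mu⟩
  exact Subsingleton.elim _ _

lemma spine (h : RealizesPivots lam mu p R) (hp : 0 < p) (hR : 0 < R) :
    RealizesPivots lam mu (lam - 1 / p) (mu - 1 / R) := by
  obtain ⟨n, G, e, hG, h₁, h₂⟩ := h
  exact ⟨n + 1, attachLeaf G e, Fin.last n, hG.attachLeaf_last, h₁.attachLeaf_last hp,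
    h₂.attachLeaf_last hR⟩

lemma leaves (hlam : 0 < lam) (hmu : 0 < mu) (h : RealizesPivots lam mu p R) (k : ℕ) :
    RealizesPivots lam mu (p - k / lam) (R - k / mu) := by
  induction k with
  | zero => simpa using h
  | succ k ih =>
    obtain ⟨n, G, e, hG, h₁, h₂⟩ := ih
    refine ⟨n + 1, attachLeaf G e, e.castSucc, hG.attachLeaf_castSucc, ?_, ?_⟩
    · convert h₁.attachLeaf_castSucc hlam using 1
      push_cast
      ring
    · convert h₂.attachLeaf_castSucc hmu using 1
      push_cast
      ring

lemma exists_lam1_mem_Icc (h : RealizesPivots lam mu p R) (hp : p ≤ 0) (hR : 0 ≤ R) :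
    ∃ (n : ℕ) (G : SimpleGraph (Fin n)), IsCaterpillar G ∧ lam1 G ∈ Set.Icc (-mu) (-lam) := by
  obtain ⟨n, G, e, hG, ⟨x, hx, hAx⟩, ⟨y, hy, hAy⟩⟩ := h
  have hlow (t : ℝ) (ht : ∃ x : Fin n → ℝ, x ≠ 0 ∧ (adjMat G).mulVec x = t • x) : -mu ≤ t := by
    obtain ⟨z, hz, hAz⟩ := ht
    refine (abs_le.1 (abs_le_of_mulVec_le G hy (fun v => ?_) hz hAz)).1
    rw [hAy]
    split_ifs
    · linarith [mul_nonneg hR (hy v).le]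
    · linarith
  obtain ⟨t, htle, ht⟩ := exists_eigenvalue_le_neg (c := lam) hG.1.isAcyclic e hx (fun v => by
    rw [hAx]
    split_ifs
    · linarith [mul_nonpos_of_nonpos_of_nonneg hp (hx v).le]
    · linarith)
  exact ⟨n, G, hG.isCaterpillar, le_csInf ⟨t, ht⟩ hlow, (csInf_le ⟨-mu, hlow⟩ ht).trans htle⟩

end RealizesPivots

section greedy

variable {α lam : ℝ}

lemma lam_sub_inv_le (h0 : 0 < α) (hlam : α ^ 2 + 1 = lam * α) (h4 : α ^ 4 + α ^ 2 < 1) :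
    lam - 1 / lam ≤ 2 / (α + 1 / lam) := by
  have hl : 0 < lam := by
    by_contra! h
    nlinarith
  have hle : lam = (α ^ 2 + 1) / α := by
    rw [hlam, mul_div_cancel_right₀ _ h0.ne']
  have hβ : 0 < α + 1 / lam := by positivity
  rw [le_div_iff₀ hβ, hle]
  field_simp
  nlinarith [sq_nonneg α, mul_pos h0 h0]

lemma lam_sub_sub_pos (h0 : 0 < α) (hlam : α ^ 2 + 1 = lam * α) (h4 : α ^ 4 + α ^ 2 < 1) :
    0 < lam - α - (α + 1 / lam) := by
  have hle : lam = (α ^ 2 + 1) / α := by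
    rw [hlam, mul_div_cancel_right₀ _ h0.ne']
  have : lam - α - (α + 1 / lam) = (1 - (α ^ 4 + α ^ 2)) / (α * (α ^ 2 + 1)) := by
    rw [hle]
    field_simp
    ring
  rw [this]
  exact div_pos (by linarith) (by positivity)

/-- Two different orbits cannot follow the same greedy itinerary forever. -/
lemma exists_le_of_greedy (h0 : 0 < α) (hlam : α ^ 2 + 1 = lam * α) (h4 : α ^ 4 + α ^ 2 < 1)
    {r s : ℕ → ℝ} {a : ℕ → ℕ} (hαr : ∀ j, α ≤ r j) (hrs : r 0 < s 0)
    (hr : ∀ j, r (j + 1) = lam - 1 / r j - a j / lam)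
    (hs : ∀ j, s (j + 1) = lam - 1 / s j - a j / lam) :
    ∃ j, α + 1 / lam ≤ s j := by
  by_contra! hsβ
  have hl : 0 < lam := by
    by_contra! h
    nlinarith
  have h1 : α < 1 := by nlinarith [pow_pos h0 4]
  set β := α + 1 / lam with hβ
  obtain ⟨d, hd⟩ : ∃ d, d = lam - α - β := ⟨_, rfl⟩
  have hd0 : 0 < d := hd ▸ lam_sub_sub_pos h0 hlam h4
  have hr0 (j : ℕ) : 0 < r j := h0.trans_le (hαr j)
  have hdiff (j : ℕ) (hj : r j < s j) :
      s (j + 1) - r (j + 1) = (s j - r j) / (r j * s j) := by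
    have := hr0 j
    have := this.trans hj
    rw [hr, hs]
    field_simp
    ring
  have hlt (j : ℕ) : r j < s j := by
    induction j with
    | zero => exact hrs
    | succ j ih =>
      have := div_pos (sub_pos.2 ih) (mul_pos (hr0 j) ((hr0 j).trans ih))
      rw [← hdiff j ih] at this
      linarith
  have hαs (j : ℕ) : α < s j := (hαr j).trans_lt (hlt j)
  have hs0 (j : ℕ) : 0 < s j := h0.trans (hαs j)
  set q : ℝ → ℝ := fun y => lam * y - y ^ 2 - 1 with hq
  have hqfac (y : ℝ) : q y = (lam - α - y) * (y - α) := by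
    simp only [hq]
    linear_combination -hlam
  have hqd (j : ℕ) : d * (s j - α) ≤ q (s j) := by
    rw [hqfac]
    exact mul_le_mul_of_nonneg_right (by linarith [hsβ j]) (by linarith [hαs j])
  have hqpos (j : ℕ) : 0 < q (s j) :=
    (mul_pos hd0 (sub_pos.2 (hαs j))).trans_le (hqd j)
  have hqmap (j : ℕ) : q (lam - 1 / s j) = q (s j) / s j ^ 2 := by
    have := hs0 j
    simp only [hq]
    field_simp
    ring
  have hqstep (j : ℕ) : q (s (j + 1)) ≤ q (s j) / s j ^ 2 := by
    rw [← hqmap, hs]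
    have hinv : 1 / β < 1 / s j := one_div_lt_one_div_of_lt (hs0 j) (hsβ j)
    have hkey := lam_sub_inv_le h0 hlam h4
    rw [← hβ, ← mul_one_div 2 β] at hkey
    rcases Nat.eq_zero_or_pos (a j) with ha | ha
    · simp [ha]
    · have ha1 : 1 / lam ≤ a j / lam := by
        gcongr
        exact_mod_cast ha
      have hal : 0 ≤ a j / lam := by positivity
      have : q (lam - 1 / s j) - q (lam - 1 / s j - a j / lam) =
          a j / lam * (lam - 2 * (lam - 1 / s j) + a j / lam) := by
        simp only [hq]
        ring
      have := mul_nonneg hal (show 0 ≤ lam - 2 * (lam - 1 / s j) + a j / lam by linarith)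
      linarith
  set D : ℕ → ℝ := fun j => (s j - r j) / q (s j) with hD
  have hDpos (j : ℕ) : 0 < D j := div_pos (sub_pos.2 (hlt j)) (hqpos j)
  have hDstep (j : ℕ) : D j * (s j / r j) ≤ D (j + 1) := by
    have h1 := hr0 j
    have h2 := hs0 j
    have h3 := hqpos j
    calc D j * (s j / r j) = ((s j - r j) / (r j * s j)) / (q (s j) / s j ^ 2) := by
          simp only [hD]
          field_simp
      _ ≤ ((s j - r j) / (r j * s j)) / q (s (j + 1)) :=
          div_le_div_of_nonneg_left
            (div_nonneg (sub_nonneg.2 (hlt j).le) (mul_pos h1 h2).le) (hqpos _) (hqstep j)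
      _ = D (j + 1) := by rw [← hdiff j (hlt j)]
  have hone (j : ℕ) : 1 ≤ s j / r j := (one_le_div (hr0 j)).2 (hlt j).le
  have hDmono : Monotone D := monotone_nat_of_le_succ fun j =>
    (le_mul_of_one_le_right (hDpos j).le (hone j)).trans (hDstep j)
  have hDbdd (j : ℕ) : D j ≤ 1 / d := by
    rw [hD, div_le_div_iff₀ (hqpos j) hd0]
    nlinarith [hqd j, hαr j]
  have hDlim : Filter.Tendsto D Filter.atTop (nhds (⨆ j, D j)) :=
    tendsto_atTop_ciSup hDmono ⟨1 / d, Set.forall_mem_range.2 hDbdd⟩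
  have hDdiff : Filter.Tendsto (fun j => D (j + 1) - D j) Filter.atTop (nhds 0) := by
    simpa using (hDlim.comp (Filter.tendsto_add_atTop_nat 1)).sub hDlim
  -- The excess over `α` is controlled by the increments of `D`.
  have hexc (j : ℕ) : D 0 ^ 2 * d * (s j - α) ≤ β * (D (j + 1) - D j) := by
    have hstep : D j * (s j - r j) ≤ r j * (D (j + 1) - D j) := by
      have := mul_le_mul_of_nonneg_left (hDstep j) (hr0 j).le
      have e : r j * (D j * (s j / r j)) = D j * s j := by
        have := hr0 j
        field_simp
      linarith
    have hsr : s j - r j = D j * q (s j) := by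
      simp only [hD]
      rw [div_mul_cancel₀ _ (hqpos j).ne']
    have hinc : 0 ≤ D (j + 1) - D j := sub_nonneg.2 (hDmono j.le_succ)
    have hD0 : D 0 ^ 2 ≤ D j ^ 2 := pow_le_pow_left₀ (hDpos 0).le (hDmono j.zero_le) 2
    calc D 0 ^ 2 * d * (s j - α) = D 0 ^ 2 * (d * (s j - α)) := by ring
      _ ≤ D j ^ 2 * q (s j) :=
          mul_le_mul hD0 (hqd j) (mul_pos hd0 (sub_pos.2 (hαs j))).le (sq_nonneg _)
      _ = D j * (s j - r j) := by rw [hsr]; ring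
      _ ≤ r j * (D (j + 1) - D j) := hstep
      _ ≤ β * (D (j + 1) - D j) :=
          mul_le_mul_of_nonneg_right ((hlt j).le.trans (hsβ j).le) hinc
  have hK : 0 < D 0 ^ 2 * d := mul_pos (pow_pos (hDpos 0) 2) hd0
  have hslim : Filter.Tendsto (fun j => s j - α) Filter.atTop (nhds 0) := by
    refine squeeze_zero (fun j => sub_nonneg.2 (hαs j).le)
      (fun j => (le_div_iff₀' hK).2 (hexc j)) ?_
    simpa using (hDdiff.const_mul β).div_const (D 0 ^ 2 * d)
  obtain ⟨N, hN⟩ := Filter.eventually_atTop.1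
    (hslim.eventually (gt_mem_nhds (sub_pos.2 h1)))
  have hgrow (k : ℕ) : s N - r N ≤ s (N + k) - r (N + k) := by
    induction k with
    | zero => rfl
    | succ k ih =>
      refine ih.trans ?_
      rw [← add_assoc, hdiff _ (hlt _)]
      refine le_div_self (sub_nonneg.2 (hlt _).le) (mul_pos (hr0 _) (hs0 _)) ?_
      have h1 := hN (N + k) (by lia)
      have h2 := hlt (N + k)
      exact mul_le_one₀ (by linarith) (hs0 _).le (by linarith)
  obtain ⟨M, hM⟩ := Filter.eventually_atTop.1
    (hslim.eventually (gt_mem_nhds (sub_pos.2 (hlt N))))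
  have h1 := hgrow M
  have h2 := hM (N + M) (by lia)
  have h3 := hαr (N + M)
  linarith

lemma exists_sub_div_mem_Ico (hl : 0 < lam) {z : ℝ} (hz : α ≤ z) :
    ∃ k : ℕ, z - k / lam ∈ Set.Ico α (α + 1 / lam) := by
  refine ⟨⌊lam * (z - α)⌋₊, ?_, ?_⟩
  · have := Nat.floor_le (mul_nonneg hl.le (sub_nonneg.2 hz))
    rw [← div_le_iff₀' hl] at this
    linarith
  · have := Nat.lt_floor_add_one (lam * (z - α))
    rw [← lt_div_iff₀' hl, add_div] at this
    linarith

namespace RealizesPivots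

variable {mu : ℝ}

lemma exists_nonpos {p R : ℝ} (h : RealizesPivots lam mu p R) (h0 : 0 < α) (h1 : α < 1)
    (hlam : α ^ 2 + 1 = lam * α) (hmu : lam ≤ mu) (hp : p < α) (hR : α ≤ R) :
    ∃ p' R', RealizesPivots lam mu p' R' ∧ p' ≤ 0 ∧ 0 ≤ R' := by
  by_contra! hcon
  have key (k : ℕ) : ∃ p' R', RealizesPivots lam mu p' R' ∧ α ≤ R' ∧
      (1 / α) ^ k * (α - p) ≤ α - p' := by
    induction k with
    | zero => exact ⟨p, R, h, hR, by simp⟩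
    | succ k ih =>
      obtain ⟨p', R', h', hR', hk⟩ := ih
      have hR0 : 0 < R' := h0.trans_le hR'
      have hp0 : 0 < p' := by
        by_contra! hneg
        exact (hcon p' R' h' hneg).not_ge hR0.le
      have hlamα : lam = α + 1 / α := by
        field_simp
        linarith
      have hpα : 0 ≤ α - p' := le_trans (mul_nonneg (by positivity) (by linarith)) hk
      refine ⟨_, _, h'.spine hp0 hR0, ?_, ?_⟩
      · have := one_div_le_one_div_of_le h0 hR'
        linarith
      · have e : α - (lam - 1 / p') = 1 / α * ((α - p') / p') := by
          rw [hlamα]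
          field_simp
          ring
        rw [e, pow_succ', mul_assoc]
        refine mul_le_mul_of_nonneg_left (hk.trans ?_) (by positivity)
        exact le_div_self hpα hp0 (by linarith)
  obtain ⟨k, hk⟩ := pow_unbounded_of_one_lt (α / (α - p)) ((one_lt_div h0).2 h1)
  obtain ⟨p', R', h', hR', hle⟩ := key k
  rw [div_lt_iff₀ (sub_pos.2 hp)] at hk
  exact (hcon p' R' h' (by linarith)).not_ge (h0.le.trans hR')

lemma exists_nonpos_nonneg (h0 : 0 < α) (hlam : α ^ 2 + 1 = lam * α)
    (h4 : α ^ 4 + α ^ 2 < 1) (hmu : lam < mu) :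
    ∃ p R, RealizesPivots lam mu p R ∧ p ≤ 0 ∧ 0 ≤ R := by
  have hl : 0 < lam := by
    by_contra! h
    nlinarith
  have hm : 0 < mu := hl.trans hmu
  have h1 : α < 1 := by nlinarith [pow_pos h0 4]
  have hlamα : lam = α + 1 / α := by
    field_simp
    linarith
  have hdiv (k : ℕ) : (k : ℝ) / mu ≤ k / lam := by gcongr
  choose! f hf using fun z (hz : α ≤ z) => exists_sub_div_mem_Ico (α := α) hl hz
  let r : ℕ → ℝ := fun j => Nat.rec (lam - f lam / lam)
    (fun _ y => lam - 1 / y - f (lam - 1 / y) / lam) j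
  let s : ℕ → ℝ := fun j => Nat.rec (mu - f lam / lam)
    (fun j y => lam - 1 / y - f (lam - 1 / r j) / lam) j
  have hαlam : α ≤ lam := by
    rw [hlamα]
    linarith [one_div_pos.2 h0]
  have hαf {y : ℝ} (hy : α ≤ y) : α ≤ lam - 1 / y := by
    linarith [one_div_le_one_div_of_le h0 hy]
  have hrmem (j : ℕ) : r j ∈ Set.Ico α (α + 1 / lam) := by
    induction j with
    | zero => exact hf lam hαlam
    | succ j ih => exact hf _ (hαf ih.1)
  obtain ⟨j, hj⟩ := exists_le_of_greedy (s := s) (a := fun j => f (lam - 1 / r j)) h0 hlam h4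
    (fun j => (hrmem j).1) (sub_lt_sub_right hmu _) (fun _ => rfl) (fun _ => rfl)
  have hreach (j : ℕ) : r j < s j ∧ ∃ R, s j ≤ R ∧ RealizesPivots lam mu (r j) R := by
    induction j with
    | zero =>
      exact ⟨sub_lt_sub_right hmu _, _, sub_le_sub_left (hdiv _) _,
        (base lam mu).leaves hl hm (f lam)⟩
    | succ j ih =>
      obtain ⟨hrs, R, hsR, hR⟩ := ih
      have hr0 : 0 < r j := h0.trans_le (hrmem j).1
      refine ⟨?_, _, ?_, (hR.spine hr0 (hr0.trans (hrs.trans_le hsR))).leaves hl hm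
        (f (lam - 1 / r j))⟩
      · exact sub_lt_sub_right (sub_lt_sub_left (one_div_lt_one_div_of_lt hr0 hrs) _) _
      · exact sub_le_sub (sub_le_sub hmu.le (one_div_le_one_div_of_le (hr0.trans hrs) hsR))
          (hdiv _)
  obtain ⟨-, R, hsR, hR⟩ := hreach j
  have hleaf := hR.leaves hl hm 1
  have := hdiv 1
  rw [Nat.cast_one] at hleaf this
  exact hleaf.exists_nonpos h0 h1 hlam hmu.le (by linarith [(hrmem j).2]) (by linarith)

end RealizesPivots

lemma exists_small_root (h : √(2 + √5) < lam) :
    ∃ α : ℝ, 0 < α ∧ α ^ 2 + 1 = lam * α ∧ α ^ 4 + α ^ 2 < 1 := by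
  have h5 : √5 ^ 2 = 5 := Real.sq_sqrt (by norm_num)
  have h52 : 2 < √5 := Real.lt_sqrt_of_sq_lt (by norm_num)
  have hl : 0 < lam := (Real.sqrt_nonneg _).trans_lt h
  have hl2 : 2 + √5 < lam ^ 2 := (Real.sqrt_lt' hl).1 h
  set w := √(lam ^ 2 - 4) with hw
  have hw2 : w ^ 2 = lam ^ 2 - 4 := Real.sq_sqrt (by linarith)
  have hw0 : 0 < w := Real.sqrt_pos.2 (by linarith)
  have hwl : w < lam := by nlinarith
  have hroot : ((lam - w) / 2) ^ 2 + 1 = lam * ((lam - w) / 2) := by linear_combination hw2 / 4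
  refine ⟨(lam - w) / 2, by linarith, hroot, ?_⟩
  set α := (lam - w) / 2 with hα
  have hα0 : 0 < α := by linarith
  have hα1 : α < 1 := by
    have : α * ((lam + w) / 2) = 1 := by rw [hα]; linear_combination -hw2 / 4
    nlinarith
  have hsq : (α ^ 2 + 1) ^ 2 = lam ^ 2 * α ^ 2 := by rw [hroot]; ring
  obtain ⟨A, hA⟩ : ∃ A, A = α ^ 2 := ⟨_, rfl⟩
  have hA0 : 0 < A := hA ▸ by positivity
  have hA1 : A < 1 := by rw [hA]; nlinarith
  rw [← hA] at hsq
  have hquad : 0 < (A - (√5 - 1) / 2) * (A - (√5 + 1) / 2) := by nlinarith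
  have hAlt : A < (√5 - 1) / 2 := by
    by_contra! hge
    nlinarith
  have : α ^ 4 + α ^ 2 = A ^ 2 + A := by rw [hA]; ring
  rw [this]
  nlinarith

end greedy

/-- For every `λ ≥ λ' = √(2 + √5)` and every `ε > 0`, there exists a caterpillar tree `G`
such that `λ₁(G) ∈ (-λ - ε, -λ)`. -/
theorem exists_caterpillar_lam1_mem_Ioo (lam : ℝ)
    (hlam : Real.sqrt (2 + Real.sqrt 5) ≤ lam) (ε : ℝ) (hε : 0 < ε) :
    ∃ (n : ℕ) (G : SimpleGraph (Fin n)),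
      IsCaterpillar G ∧ lam1 G ∈ Set.Ioo (-lam - ε) (-lam) := by
  obtain ⟨α, h0, hα, h4⟩ := exists_small_root (lam := lam + ε / 3) (by linarith)
  obtain ⟨p, R, h, hp, hR⟩ := RealizesPivots.exists_nonpos_nonneg h0 hα h4
    (show lam + ε / 3 < lam + ε / 2 by linarith)
  obtain ⟨n, G, hG, hlow, hup⟩ := h.exists_lam1_mem_Icc hp hR
  exact ⟨n, G, hG, by linarith, by linarith⟩
end
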